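/- arXiv:1711.07129 — 7 statements merged into one kernel-verified Lean document; each statement's English description precedes it below -/
import Mathlib

section
/- Let n ≥ 5 and let a_1, …, a_n be n distinct integers such that the difference set A = {a_j − a_i : 1 ≤ i < j ≤ n} has cardinality exactly n. Then there exists an integer d such that the sequence (a_1, …, a_n) is of one of the following three types: (1) it equals the arithmetic progression (a_1, a_1+d, a_1+2d, …, a_1+nd) with exactly one term a_1+kd omitted, for some integer k with 1 ≤ k ≤ n−1; (2) it equals (a_1, a_1+2d, a_1+3d, …, a_1+(n−1)d, a_1+(n+1)d); (3) it is obtained from the arithmetic progression (a_1, a_1+d, …, a_1+(n−1)d) by applying a permutation σ that is a product of disjoint transpositions of adjacent positions (i_1, i_1+1)⋯(i_l, i_l+1). -/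
/-- The difference set of a finite sequence `a`, namely `{a j - a i | i < j}`. -/
def diffSet {n : ℕ} (a : Fin n → ℤ) : Finset ℤ :=
  Finset.image (fun p : Fin n × Fin n => a p.2 - a p.1)
    (Finset.univ.filter fun p : Fin n × Fin n => p.1 < p.2)

/-- A permutation of `{0, …, n-1}` which is a product of disjoint transpositions of
adjacent positions: it is an involution moving every point by at most `1`. -/
def IsDisjointAdjTranspProd {n : ℕ} (σ : Equiv.Perm (Fin n)) : Prop :=
  σ * σ = 1 ∧ ∀ i : Fin n, σ i = i ∨ (σ i : ℕ) = (i : ℕ) + 1 ∨ (i : ℕ) = (σ i : ℕ) + 1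

theorem gap_struct (n : ℕ) (hn : 5 ≤ n) (b : ℕ → ℤ) (r : ℕ → ℕ → ℕ)
    (hb : ∀ i j, i < j → j < n → b i < b j)
    (h1 : ∀ i j, i < j → j < n → j - i ≤ r i j)
    (h2 : ∀ i j, i < j → j < n → r i j ≤ j - i + 1)
    (h4 : ∀ i j k l, i < j → j < n → k < l → l < n → r i j = r k l → b j - b i = b l - b k)
    (h6 : ∀ i j k l, i < j → j < n → k < l → l < n → r i j < r k l → b j - b i < b l - b k)
    (h5 : ∀ i j k l, k ≤ i → i < j → j ≤ l → l < n → r i j + (i - k) + (l - j) ≤ r k l) :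
    ∃ d : ℤ, 0 < d ∧ ((∀ i, i < n → b i = b 0 + i * d) ∨
      (∃ k : ℕ, 1 ≤ k ∧ k ≤ n - 1 ∧ ∀ i, i < n → b i = b 0 + (if i < k then (i:ℤ) else i + 1) * d) ∨
      (∀ i, i < n → b i = b 0 + (if i = 0 then (0:ℤ) else if i = n - 1 then (n:ℤ) + 1 else i + 1) * d)) := by
  have hg : ∀ i, i + 1 < n → r i (i+1) = 1 ∨ r i (i+1) = 2 := by
    intro i hi
    have := h1 i (i+1) (by omega) hi
    have := h2 i (i+1) (by omega) hi
    omega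
  by_cases hall : ∀ i, i + 1 < n → r i (i+1) = r 0 1
  · refine ⟨b 1 - b 0, by have := hb 0 1 (by omega) (by omega); omega, Or.inl ?_⟩
    intro i
    induction i with
    | zero => intro _; simp
    | succ i ih =>
      intro hi
      have := ih (by omega)
      have := h4 i (i+1) 0 1 (by omega) hi (by omega) (by omega) (hall i hi)
      push_cast; linarith
  -- adjacent mixed
  have hmix : ∃ i, i + 2 < n ∧ r i (i+1) ≠ r (i+1) (i+2) := by
    by_contra hc
    push Not at hc
    apply hall
    intro i
    induction i with
    | zero => intro _; simp
    | succ i ih =>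
      intro hi
      rw [← hc i hi]; exact ih (by omega)
  obtain ⟨m, hm, hmne⟩ := hmix
  have huw : ∃ u w : ℤ, 0 < u ∧ u < w ∧ (∀ i j, i < j → j < n → r i j = 1 → b j - b i = u) ∧
      (∀ i j, i < j → j < n → r i j = 2 → b j - b i = w) ∧
      (∀ i j, i < j → j < n → r i j = 3 → b j - b i = u + w) := by
    have x1 := hg m (by omega)
    have x2 := hg (m+1) (by omega)
    have p1 := hb m (m+1) (by omega) (by omega)
    have p2 := hb (m+1) (m+2) (by omega) (by omega)
    have e : m + 1 + 1 = m + 2 := rfl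
    rw [e] at x2
    have h02 : r m (m+2) = 3 := by
      have := h2 m (m+2) (by omega) hm
      have := h5 m (m+1) m (m+2) (by omega) (by omega) (by omega) hm
      have := h5 (m+1) (m+2) m (m+2) (by omega) (by omega) (by omega) hm
      omega
    have h3 : ∀ i j, i < j → j < n → r i j = 3 → b j - b i = b (m+2) - b m := fun i j hi hj h =>
      h4 i j m (m+2) hi hj (by omega) (by omega) (by omega)
    rcases x1 with x1 | x1
    · have x2 : r (m+1) (m+2) = 2 := by omega
      refine ⟨b (m+1) - b m, b (m+2) - b (m+1), by omega,
        h6 _ _ _ _ (by omega) (by omega) (by omega) (by omega) (by omega), ?_, ?_, ?_⟩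
      · exact fun i j hi hj h => h4 _ _ _ _ hi hj (by omega) (by omega) (by omega)
      · exact fun i j hi hj h => h4 _ _ _ _ hi hj (by omega) (by omega) (by omega)
      · intro i j hi hj h; rw [h3 i j hi hj h]; ring
    · have x2 : r (m+1) (m+2) = 1 := by omega
      refine ⟨b (m+2) - b (m+1), b (m+1) - b m, by omega,
        h6 _ _ _ _ (by omega) (by omega) (by omega) (by omega) (by omega), ?_, ?_, ?_⟩
      · exact fun i j hi hj h => h4 _ _ _ _ hi hj (by omega) (by omega) (by omega)
      · exact fun i j hi hj h => h4 _ _ _ _ hi hj (by omega) (by omega) (by omega)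
      · intro i j hi hj h; rw [h3 i j hi hj h]; ring
  obtain ⟨u, w, hu, huw, hr1, hr2, hr3⟩ := huw
  have g1 : ∀ i, i + 1 < n → r i (i+1) = 1 → b (i+1) - b i = u := fun i hi h => hr1 i (i+1) (by omega) hi h
  have g2 : ∀ i, i + 1 < n → r i (i+1) = 2 → b (i+1) - b i = w := fun i hi h => hr2 i (i+1) (by omega) hi h
  -- no two adjacent 2s
  have hno : ∀ i, i + 2 < n → r i (i+1) = 2 → r (i+1) (i+2) = 2 → False := by
    intro i hi ha hb'
    have := g2 i (by omega) ha
    have := g2 (i+1) hi hb'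
    have h3 : r i (i+2) = 3 := by
      have := h2 i (i+2) (by omega) hi
      have := h5 i (i+1) i (i+2) (by omega) (by omega) (by omega) hi
      omega
    have := hr3 i (i+2) (by omega) hi h3
    have : i + 1 + 1 = i + 2 := rfl
    simp only [this] at *
    linarith
  have h11 : ∃ i, i + 2 < n ∧ r i (i+1) = 1 ∧ r (i+1) (i+2) = 1 := by
    by_contra hc
    push Not at hc
    have a0 := hg 0 (by omega)
    have a1 := hg 1 (by omega)
    have a2 := hg 2 (by omega)
    have a3 := hg 3 (by omega)
    have n0 := hno 0 (by omega)
    have n1 := hno 1 (by omega)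
    have n2 := hno 2 (by omega)
    have c0 := hc 0 (by omega)
    have c1 := hc 1 (by omega)
    have c2 := hc 2 (by omega)
    simp only [Nat.reduceAdd] at *
    have e1 : r 0 3 = r 1 4 := by
      have := h2 0 3 (by omega) (by omega)
      have := h2 1 4 (by omega) (by omega)
      have := h5 1 2 0 3 (by omega) (by omega) (by omega) (by omega)
      have := h5 2 3 0 3 (by omega) (by omega) (by omega) (by omega)
      have := h5 1 2 1 4 (by omega) (by omega) (by omega) (by omega)
      have := h5 2 3 1 4 (by omega) (by omega) (by omega) (by omega)
      grind
    have e2 := h4 0 3 1 4 (by omega) (by omega) (by omega) (by omega) e1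
    have u0 := g1 0 (by omega)
    have w0 := g2 0 (by omega)
    have u3 := g1 3 (by omega)
    have w3 := g2 3 (by omega)
    simp only [Nat.reduceAdd] at *
    grind
  have hw : w = 2 * u := by
    obtain ⟨i, hi, ha, hb'⟩ := h11
    have t1 := g1 i (by omega) ha
    have t2 := g1 (i+1) hi hb'
    have := h1 i (i+2) (by omega) hi
    have := h2 i (i+2) (by omega) hi
    have e : i + 1 + 1 = i + 2 := rfl
    simp only [e] at *
    have : r i (i+2) = 2 ∨ r i (i+2) = 3 := by omega
    rcases this with h | h
    · have := hr2 i (i+2) (by omega) hi h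
      linarith
    · have := hr3 i (i+2) (by omega) hi h
      linarith
  have hend : ∀ p q, p < q → q + 1 < n → r p (p+1) = 2 → r q (q+1) = 2 → p = 0 ∧ q + 2 = n := by
    intro p q hpq hq hp2 hq2
    have f0 : r p (q+1) = q - p + 2 := by
      have := h2 p (q+1) (by omega) hq
      have := h5 p (p+1) p (q+1) (by omega) (by omega) (by omega) hq
      omega
    constructor
    · by_contra hp0
      obtain ⟨p, rfl⟩ : ∃ p', p = p' + 1 := ⟨p - 1, by omega⟩
      have f1 : r p q = q - (p + 1) + 2 := by
        have := h2 p q (by omega) (by omega)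
        have := h5 (p+1) (p+1+1) p q (by omega) (by omega) (by omega) (by omega)
        omega
      have := h4 p q (p+1) (q+1) (by omega) (by omega) (by omega) (by omega) (by omega)
      have x2 := g2 q (by omega) hq2
      rcases hg p (by omega) with h | h
      · have := g1 p (by omega) h
        linarith
      · exact hno p (by omega) h hp2
    · by_contra hp0
      have f1 : r (p+1) (q+2) = q - p + 2 := by
        have := h2 (p+1) (q+2) (by omega) (by omega)
        have := h5 q (q+1) (p+1) (q+2) (by omega) (by omega) (by omega) (by omega)
        omega
      have := h4 (p+1) (q+2) p (q+1) (by omega) (by omega) (by omega) (by omega) (by omega)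
      have x2 := g2 p (by omega) hp2
      rcases hg (q+1) (by omega) with h | h
      · have := g1 (q+1) (by omega) h
        have e : q + 1 + 1 = q + 2 := rfl
        simp only [e] at *
        linarith
      · exact hno q (by omega) hq2 h
  refine ⟨u, hu, Or.inr ?_⟩
  have hex : ∃ p, p + 1 < n ∧ r p (p+1) = 2 := by
    have x1 := hg m (by omega)
    have x2 := hg (m+1) (by omega)
    have e : m + 1 + 1 = m + 2 := rfl
    rw [e] at x2
    by_cases h : r m (m+1) = 2
    · exact ⟨m, by omega, h⟩
    · exact ⟨m+1, by omega, by rw [e]; omega⟩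
  obtain ⟨p, hp, hp2⟩ := hex
  by_cases hun : ∀ q, q + 1 < n → r q (q+1) = 2 → q = p
  · left
    refine ⟨p+1, by omega, by omega, ?_⟩
    intro i
    induction i with
    | zero => intro _; simp
    | succ i ih =>
      intro hi
      have ih := ih (by omega)
      rcases hg i hi with h | h
      · have hne : i ≠ p := by rintro rfl; omega
        have := g1 i hi h
        by_cases hlt : i < p + 1
        · have : i + 1 < p + 1 := by omega
          simp only [hlt, this, if_true] at *
          push_cast; linarith
        · have : ¬ i + 1 < p + 1 := by omega
          simp only [hlt, this, if_false] at *
          push_cast; linarith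
      · have := hun i hi h
        subst this
        have := g2 i hi h
        simp at *
        linarith
  · right
    have hA : r 0 1 = 2 ∧ r (n-2) (n-1) = 2 ∧ ∀ i, i + 1 < n → i ≠ 0 → i ≠ n - 2 → r i (i+1) = 1 := by
      push Not at hun
      obtain ⟨q, hq, hq2, hqp⟩ := hun
      have hx : ∃ q, q + 2 = n ∧ r 0 1 = 2 ∧ r q (q+1) = 2 := by
        rcases lt_or_gt_of_ne hqp with h | h
        · obtain ⟨rfl, h'⟩ := hend q p h hp hq2 hp2
          exact ⟨p, h', hq2, hp2⟩
        · obtain ⟨rfl, h'⟩ := hend p q h hq hp2 hq2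
          exact ⟨q, h', hp2, hq2⟩
      obtain ⟨q, rfl, e1, e2⟩ := hx
      refine ⟨e1, e2, ?_⟩
      intro i hi hi0 hi2
      rcases hg i hi with h | h
      · exact h
      · have := hend 0 i (by omega) hi e1 h
        omega
    obtain ⟨e1, e2, e3⟩ := hA
    have hmid : ∀ i, i + 2 < n → b (i+1) = b 0 + ((i:ℤ)+2) * u := by
      intro i
      induction i with
      | zero =>
        intro _
        have := g2 0 (by omega) e1
        simp at *; linarith
      | succ i ih =>
        intro hi
        have := ih (by omega)
        have := g1 (i+1) (by omega) (e3 (i+1) (by omega) (by omega) (by omega))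
        push_cast; linarith
    intro i hi
    by_cases hi0 : i = 0
    · simp [hi0]
    by_cases hi1 : i = n - 1
    · obtain ⟨q, rfl⟩ : ∃ q, n = q + 3 := ⟨n - 3, by omega⟩
      have t1 := hmid q (by omega)
      have t2 := g2 (q+1) (by omega) e2
      have e : q + 3 - 1 = q + 2 := rfl
      have e' : q + 1 + 1 = q + 2 := rfl
      rw [if_neg hi0, if_pos hi1, hi1, e]
      rw [e'] at t2
      push_cast; linarith
    · obtain ⟨q, rfl⟩ : ∃ q, i = q + 1 := ⟨i - 1, by omega⟩
      have t1 := hmid q (by omega)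
      rw [if_neg hi0, if_neg hi1, t1]
      push_cast; ring

theorem sorted_struct (n : ℕ) (hn : 5 ≤ n) (b : ℕ → ℤ) (D : Finset ℤ)
    (hb : ∀ i j, i < j → j < n → b i < b j)
    (hD : ∀ i j, i < j → j < n → b j - b i ∈ D) (hc : D.card ≤ n) :
    ∃ d : ℤ, 0 < d ∧ ((∀ i, i < n → b i = b 0 + i * d) ∨
      (∃ k : ℕ, 1 ≤ k ∧ k ≤ n - 1 ∧ ∀ i, i < n → b i = b 0 + (if i < k then (i:ℤ) else i + 1) * d) ∨
      (∀ i, i < n → b i = b 0 + (if i = 0 then (0:ℤ) else if i = n - 1 then (n:ℤ) + 1 else i + 1) * d)) := by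
  have hs : ∀ x y : ℤ, x < y → y ∈ D → (D.filter (· ≤ x)).card < (D.filter (· ≤ y)).card := by
    intro x y hxy hy
    apply Finset.card_lt_card
    rw [Finset.ssubset_iff_of_subset]
    · exact ⟨y, by simp [hy], by simp [hxy]⟩
    · intro z hz
      simp only [Finset.mem_filter] at *
      exact ⟨hz.1, by omega⟩
  have hR : ∀ i j, i < j → j < n → ∀ t, j + t < n → (D.filter (· ≤ b j - b i)).card + t ≤ (D.filter (· ≤ b (j+t) - b i)).card := by
    intro i j hij hj t
    induction t with
    | zero => intro _; simp
    | succ t ih =>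
      intro ht
      have := ih (by omega)
      have h := hb (j+t) (j+(t+1)) (by omega) ht
      have := hs (b (j+t) - b i) (b (j+(t+1)) - b i) (by omega) (hD _ _ (by omega) ht)
      omega
  have hL : ∀ t i j, i + t < j → j < n → (D.filter (· ≤ b j - b (i+t))).card + t ≤ (D.filter (· ≤ b j - b i)).card := by
    intro t i j
    induction t with
    | zero => intro _ _; simp
    | succ t ih =>
      intro ht hj
      have := ih (by omega) hj
      have h := hb (i+t) (i+(t+1)) (by omega) (by omega)
      have := hs (b j - b (i+(t+1))) (b j - b (i+t)) (by omega) (hD _ _ (by omega) hj)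
      omega
  have h5 : ∀ i j k l, k ≤ i → i < j → j ≤ l → l < n →
      (D.filter (· ≤ b j - b i)).card + (i - k) + (l - j) ≤ (D.filter (· ≤ b l - b k)).card := by
    intro i j k l hki hij hjl hl
    have t1 := hR i j hij (by omega) (l - j) (by omega)
    have t2 := hL (i - k) k l (by omega) hl
    have e1 : j + (l - j) = l := by omega
    have e2 : k + (i - k) = i := by omega
    rw [e1] at t1
    rw [e2] at t2
    omega
  have h6 : ∀ i j k l, i < j → j < n → k < l → l < n →
      (D.filter (· ≤ b j - b i)).card < (D.filter (· ≤ b l - b k)).card → b j - b i < b l - b k := by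
    intro i j k l hij hj hkl hl h
    by_contra hc
    rcases eq_or_lt_of_le (not_lt.mp hc) with e | e
    · rw [e] at h; omega
    · have := hs _ _ e (hD i j hij hj)
      omega
  refine gap_struct n hn b (fun i j => (D.filter (· ≤ b j - b i)).card) hb ?_ ?_ ?_ h6 h5
  · intro i j hij hj
    have t := h5 i (i+1) i j le_rfl (by omega) (by omega) hj
    have : 0 < (D.filter (· ≤ b (i+1) - b i)).card := by
      apply Finset.card_pos.mpr
      exact ⟨b (i+1) - b i, by simp [hD i (i+1) (by omega) (by omega)]⟩
    show _ ≤ (D.filter (· ≤ b j - b i)).card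
    omega
  · intro i j hij hj
    have t := h5 i j 0 (n-1) (by omega) (by omega) (by omega) (by omega)
    have := Finset.card_filter_le D (· ≤ b (n-1) - b 0)
    show (D.filter (· ≤ b j - b i)).card ≤ _
    omega
  · intro i j k l hij hj hkl hl h
    rcases lt_trichotomy (b j - b i) (b l - b k) with e | e | e
    · have := hs _ _ e (hD k l hkl hl)
      exact absurd h (by show (D.filter (· ≤ b j - b i)).card ≠ (D.filter (· ≤ b l - b k)).card; omega)
    · exact e
    · have := hs _ _ e (hD i j hij hj)
      exact absurd h (by show (D.filter (· ≤ b j - b i)).card ≠ (D.filter (· ≤ b l - b k)).card; omega)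

theorem card_amb (A T X : Finset ℤ) (hT : ∀ x ∈ T, 0 < x) (hXT : X ⊆ T)
    (hA : ∀ x ∈ T, x ∈ A ∨ -x ∈ A) (hX : ∀ x ∈ X, x ∈ A ∧ -x ∈ A) :
    T.card + X.card ≤ A.card := by
  classical
  have h1 : T ⊆ (A \ X.image (fun x => -x)).image (fun x => |x|) := by
    intro x hx
    have hx0 := hT x hx
    rw [Finset.mem_image]
    by_cases h : x ∈ A
    · refine ⟨x, ?_, abs_of_pos hx0⟩
      simp only [Finset.mem_sdiff, Finset.mem_image, not_exists, not_and]
      refine ⟨h, fun y hy e => ?_⟩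
      have := hT y (hXT hy)
      omega
    · refine ⟨-x, ?_, by rw [abs_neg]; exact abs_of_pos hx0⟩
      simp only [Finset.mem_sdiff, Finset.mem_image, not_exists, not_and]
      refine ⟨(hA x hx).resolve_left h, fun y hy e => ?_⟩
      have : y = x := by omega
      subst this
      exact h (hX y hy).1
  have h2 := (Finset.card_le_card h1).trans Finset.card_image_le
  have h3 : X.image (fun x => -x) ⊆ A := by
    intro y hy
    rw [Finset.mem_image] at hy
    obtain ⟨x, hx, rfl⟩ := hy
    exact (hX x hx).2
  rw [Finset.card_sdiff_of_subset h3, Finset.card_image_of_injective _ neg_injective] at h2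
  have h4 := Finset.card_le_card h3
  rw [Finset.card_image_of_injective _ neg_injective] at h4
  omega

theorem pos_up {n : ℕ} (p : Equiv.Perm (Fin n)) (v : Fin n) (t : ℕ) (hv : (v:ℕ) < t)
    (h : ∀ w : Fin n, t ≤ w → p v < p w) : (p v : ℕ) + 1 ≤ t := by
  have : (Finset.Iio (p v)).card ≤ ((Finset.range t).erase v).card := by
    apply Finset.card_le_card_of_injOn (fun x => ((p.symm x : Fin n) : ℕ))
    · intro x hx
      rw [Finset.mem_coe, Finset.mem_Iio] at hx
      rw [Finset.mem_coe, Finset.mem_erase, Finset.mem_range]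
      constructor
      · intro e
        have : p.symm x = v := Fin.ext e
        rw [← this] at hx
        simp at hx
      · by_contra hc
        have := h (p.symm x) (not_lt.mp hc)
        rw [Equiv.apply_symm_apply] at this
        exact absurd hx (not_lt.mpr this.le)
    · intro x _ y _ e
      exact p.symm.injective (Fin.ext e)
  rw [Finset.card_erase_of_mem (by simpa using hv), Fin.card_Iio, Finset.card_range] at this
  omega

theorem pos_dn {n : ℕ} (p : Equiv.Perm (Fin n)) (v : Fin n) (t : ℕ) (hv : t ≤ v)
    (h : ∀ w : Fin n, (w:ℕ) < t → p w < p v) : t ≤ (p v : ℕ) := by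
  have : (Finset.range t).card ≤ (Finset.Iio (p v)).card := by
    apply Finset.card_le_card_of_injOn (fun i => if hi : i < n then p ⟨i, hi⟩ else p v)
    · intro i hi
      rw [Finset.mem_coe, Finset.mem_range] at hi
      have hi' : i < n := by omega
      simp only [hi', dite_true]
      rw [Finset.mem_coe, Finset.mem_Iio]
      exact h _ hi
    · intro i hi j hj e
      rw [Finset.mem_coe, Finset.mem_range] at hi hj
      have hi' : i < n := by omega
      have hj' : j < n := by omega
      simp only [hi', hj', dite_true] at e
      simpa using p.injective e
  rwa [Fin.card_Iio, Finset.card_range] at this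

theorem near_id {n : ℕ} (p : Equiv.Perm (Fin n))
    (h : ∀ v w : Fin n, (v:ℕ) + 2 ≤ w → p v < p w) : IsDisjointAdjTranspProd p := by
  have hup : ∀ v : Fin n, (p v : ℕ) ≤ v + 1 := by
    intro v
    have := pos_up p v (v+2) (by omega) (fun w hw => h v w hw)
    omega
  have hdn : ∀ v : Fin n, (v : ℕ) ≤ p v + 1 := by
    intro v
    have := pos_dn p v (v-1) (by omega) (fun w hw => h w v (by omega))
    omega
  have hinv : ∀ v, p (p v) = v := by
    intro v
    have a1 := hup v
    have a2 := hdn v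
    have a3 := hup (p v)
    have a4 := hdn (p v)
    rcases Nat.lt_trichotomy (p v) v with e | e | e
    · have hlt : ¬ p (p v) < p v := by
        intro hlt
        have := pos_dn p v v le_rfl (fun w hw => by
          by_cases hw' : (w:ℕ) + 2 ≤ v
          · exact h w v hw'
          · have : w = p v := Fin.ext (by omega)
            rw [this]; exact hlt)
        omega
      have hne : (p (p v) : ℕ) ≠ p v := by
        intro h'
        have := p.injective (Fin.ext h')
        rw [this] at e
        omega
      rw [Fin.lt_def] at hlt
      apply Fin.ext
      omega
    · have : p v = v := Fin.ext e
      rw [this, this]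
    · have hlt : ¬ p v < p (p v) := by
        intro hlt
        have := pos_up p v (v+1) (by omega) (fun w hw => by
          by_cases hw' : (v:ℕ) + 2 ≤ w
          · exact h v w hw'
          · have : w = p v := Fin.ext (by omega)
            rw [this]; exact hlt)
        omega
      have hne : (p (p v) : ℕ) ≠ p v := by
        intro h'
        have := p.injective (Fin.ext h')
        rw [this] at e
        omega
      rw [Fin.lt_def] at hlt
      apply Fin.ext
      omega
  refine ⟨Equiv.ext hinv, fun i => ?_⟩
  have a1 := hup i
  have a2 := hdn i
  have : (p i : ℕ) = i ∨ (p i : ℕ) = i + 1 ∨ (i : ℕ) = p i + 1 := by omega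
  rcases this with h | h | h
  · exact Or.inl (Fin.ext h)
  · exact Or.inr (Or.inl h)
  · exact Or.inr (Or.inr h)

theorem consec_mono {n : ℕ} (p : Equiv.Perm (Fin n))
    (h : ∀ v w : Fin n, (w:ℕ) = v + 1 → p v < p w) : ∀ v w : Fin n, v < w → p v < p w := by
  have key : ∀ t : ℕ, ∀ v w : Fin n, (w:ℕ) = v + 1 + t → p v < p w := by
    intro t
    induction t with
    | zero => intro v w e; exact h v w e
    | succ t ih =>
      intro v w e
      have h1 := ih v ⟨v + 1 + t, by omega⟩ rfl
      have h2 := h ⟨v + 1 + t, by omega⟩ w (by simp only; omega)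
      exact h1.trans h2
  intro v w hvw
  have : (v:ℕ) < w := hvw
  exact key (w - v - 1) v w (by omega)

theorem mono_id {n : ℕ} (p : Equiv.Perm (Fin n))
    (h : ∀ v w : Fin n, v < w → p v < p w) (v : Fin n) : p v = v := by
  have h1 := pos_up p v (v+1) (by omega) (fun w hw => h v w (Fin.lt_def.mpr (by omega)))
  have h2 := pos_dn p v v le_rfl (fun w hw => h w v (Fin.lt_def.mpr hw))
  exact Fin.ext (by omega)

theorem far_pos {n : ℕ} (hn : 5 ≤ n) (p : Equiv.Perm (Fin n))
    (H : ∀ k : ℕ, 2 ≤ k → (∀ v w : Fin n, (w:ℕ) = v + k → p v < p w) ∨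
      (∀ v w : Fin n, (w:ℕ) = v + k → p w < p v))
    (h0 : p ⟨0, by omega⟩ < p ⟨2, by omega⟩) :
    ∀ v w : Fin n, (v:ℕ) + 2 ≤ w → p v < p w := by
  have H2 : ∀ v w : Fin n, (w:ℕ) = v + 2 → p v < p w := by
    rcases H 2 le_rfl with h | h
    · exact h
    · exact absurd (h ⟨0, by omega⟩ ⟨2, by omega⟩ rfl) (not_lt.mpr h0.le)
  have H3 : ∀ v w : Fin n, (w:ℕ) = v + 3 → p v < p w := by
    rcases H 3 (by omega) with h | h
    · exact h
    · exfalso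
      have a1 := h ⟨0, by omega⟩ ⟨3, by omega⟩ rfl
      have a2 := h ⟨1, by omega⟩ ⟨4, by omega⟩ rfl
      have a3 := H2 ⟨0, by omega⟩ ⟨2, by omega⟩ rfl
      have a4 := H2 ⟨2, by omega⟩ ⟨4, by omega⟩ rfl
      have a5 := H2 ⟨1, by omega⟩ ⟨3, by omega⟩ rfl
      exact lt_irrefl _ (((((a1.trans a3).trans a4).trans a2).trans a5))
  have key : ∀ t : ℕ, ∀ v w : Fin n, (w:ℕ) = v + 2 + t → p v < p w := by
    intro t
    induction t using Nat.strong_induction_on with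
    | _ t ih =>
      intro v w e
      by_cases h : t = 0
      · exact H2 v w (by omega)
      by_cases h' : t = 1
      · exact H3 v w (by omega)
      · have h1 := H2 v ⟨v + 2, by omega⟩ rfl
        have h2 := ih (t - 2) (by omega) ⟨v + 2, by omega⟩ w (by simp only; omega)
        exact h1.trans h2
  intro v w hvw
  exact key (w - v - 2) v w (by omega)

theorem far_dich {n : ℕ} (hn : 5 ≤ n) (p : Equiv.Perm (Fin n))
    (H : ∀ k : ℕ, 2 ≤ k → (∀ v w : Fin n, (w:ℕ) = v + k → p v < p w) ∨
      (∀ v w : Fin n, (w:ℕ) = v + k → p w < p v)) :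
    (∀ v w : Fin n, (v:ℕ) + 2 ≤ w → p v < p w) ∨ (∀ v w : Fin n, (v:ℕ) + 2 ≤ w → p w < p v) := by
  rcases lt_or_ge (p ⟨0, by omega⟩) (p ⟨2, by omega⟩) with h | h
  · exact Or.inl (far_pos hn p H h)
  · right
    have hne : p ⟨2, by omega⟩ ≠ p ⟨0, by omega⟩ := by
      intro e
      have := p.injective e
      simp at this
    have := far_pos hn (p.trans Fin.revPerm) (fun k hk => by
      rcases H k hk with h | h
      · right
        intro v w e
        simpa using h v w e
      · left
        intro v w e
        simpa using h v w e) (by simpa using lt_of_le_of_ne h hne)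
    intro v w hvw
    simpa using this v w hvw

theorem mem_diffSet {n : ℕ} (a : Fin n → ℤ) (i j : Fin n) (h : i < j) : a j - a i ∈ diffSet a := by
  unfold diffSet
  rw [Finset.mem_image]
  exact ⟨(i, j), by simpa using h, rfl⟩

theorem mem_or {n : ℕ} (a : Fin n → ℤ) (i j : Fin n) (x : ℤ) (hx : 0 < x) (h : a j - a i = x) :
    x ∈ diffSet a ∨ -x ∈ diffSet a := by
  rcases lt_trichotomy i j with e | e | e
  · left; rw [← h]; exact mem_diffSet a i j e
  · subst e; simp at h; omega
  · right
    have := mem_diffSet a j i e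
    rwa [show a i - a j = -x by omega] at this

theorem sign_def {n : ℕ} (a : Fin n → ℤ) (p : Equiv.Perm (Fin n)) (x : ℤ) (hx : 0 < x)
    (h : ¬ (x ∈ diffSet a ∧ -x ∈ diffSet a)) :
    (∀ v w, a (p w) - a (p v) = x → p v < p w) ∨ (∀ v w, a (p w) - a (p v) = x → p w < p v) := by
  have hne : ∀ v w, a (p w) - a (p v) = x → p w ≠ p v := by
    intro v w e e'
    rw [e'] at e
    omega
  by_cases hm : x ∈ diffSet a
  · left
    intro v w e
    by_contra hc
    have := mem_diffSet a (p w) (p v) (lt_of_le_of_ne (not_lt.mp hc) (hne v w e))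
    rw [show a (p v) - a (p w) = -x by omega] at this
    exact h ⟨hm, this⟩
  · right
    intro v w e
    by_contra hc
    have := mem_diffSet a (p v) (p w) (lt_of_le_of_ne (not_lt.mp hc) (hne v w e).symm)
    rw [e] at this
    exact hm this

theorem card_amb' {n : ℕ} (a : Fin n → ℤ) (d : ℤ) (hd : 0 < d) (S Y : Finset ℤ) (hYS : Y ⊆ S)
    (hS : ∀ m ∈ S, 0 < m ∧ ∃ i j, a j - a i = m * d)
    (hY : ∀ m ∈ Y, m * d ∈ diffSet a ∧ -(m * d) ∈ diffSet a) :
    S.card + Y.card ≤ (diffSet a).card := by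
  have hi : Function.Injective (fun m : ℤ => m * d) := fun x y e => mul_right_cancel₀ hd.ne' e
  have := card_amb (diffSet a) (S.image (fun m => m * d)) (Y.image (fun m => m * d)) ?_
    (Finset.image_subset_image hYS) ?_ ?_
  · rwa [Finset.card_image_of_injective _ hi, Finset.card_image_of_injective _ hi] at this
  · intro x hx
    obtain ⟨m, hm, rfl⟩ := Finset.mem_image.mp hx
    exact mul_pos (hS m hm).1 hd
  · intro x hx
    obtain ⟨m, hm, rfl⟩ := Finset.mem_image.mp hx
    obtain ⟨h0, i, j, e⟩ := hS m hm
    exact mem_or a i j _ (mul_pos h0 hd) e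
  · intro x hx
    obtain ⟨m, hm, rfl⟩ := Finset.mem_image.mp hx
    exact hY m hm

/-- in the gap case, the sequence is monotone -/
theorem gap_mono {n : ℕ} (a : Fin n → ℤ) (hcard : (diffSet a).card = n)
    (p : Equiv.Perm (Fin n)) (d : ℤ) (hd : 0 < d) (S : Finset ℤ) (hSn : S.card = n)
    (h1 : 1 ∈ S) (h2 : 2 ∈ S)
    (hS : ∀ m ∈ S, 0 < m ∧ ∃ i j, a (p j) - a (p i) = m * d)
    (hg : ∀ v w : Fin n, (w:ℕ) = v + 1 → a (p w) - a (p v) = d ∨ a (p w) - a (p v) = 2 * d)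
    (v0 v1 v2 : Fin n) (e1 : a (p v1) - a (p v0) = d) (e2 : a (p v2) - a (p v1) = d) :
    (∀ v, p v = v) ∨ (∀ v, p v = Fin.rev v) := by
  have un : ∀ m ∈ S, ¬ (m * d ∈ diffSet a ∧ -(m * d) ∈ diffSet a) := by
    intro m hm hc
    have := card_amb' a d hd S {m} (by simpa using hm)
      (fun m hm => ⟨(hS m hm).1, by obtain ⟨_, i, j, e⟩ := hS m hm; exact ⟨_, _, e⟩⟩)
      (by simpa using hc)
    simp at this
    omega
  have s1 := sign_def a p d hd (by simpa using un 1 h1)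
  have s2 := sign_def a p (2 * d) (by omega) (un 2 h2)
  rcases s1 with s1 | s1
  · left
    have s2' : ∀ v w, a (p w) - a (p v) = 2 * d → p v < p w := by
      rcases s2 with s2 | s2
      · exact s2
      · exact absurd ((s1 _ _ e1).trans (s1 _ _ e2)) (not_lt.mpr (s2 v0 v2 (by omega)).le)
    exact mono_id p (consec_mono p (fun v w e => (hg v w e).elim (s1 v w) (s2' v w)))
  · right
    have s2' : ∀ v w, a (p w) - a (p v) = 2 * d → p w < p v := by
      rcases s2 with s2 | s2
      · exact absurd ((s1 _ _ e2).trans (s1 _ _ e1)) (not_lt.mpr (s2 v0 v2 (by omega)).le)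
      · exact s2
    have := mono_id (p.trans Fin.revPerm) (consec_mono _ (fun v w e => by
      simpa using (hg v w e).elim (s1 v w) (s2' v w)))
    intro v
    have h := this v
    simp at h
    exact Fin.rev_eq_iff.mp h

theorem ap_case {n : ℕ} (hn : 5 ≤ n) (a : Fin n → ℤ) (hcard : (diffSet a).card = n)
    (p : Equiv.Perm (Fin n)) (c d : ℤ) (hd : 0 < d)
    (h : ∀ v : Fin n, a (p v) = c + (v:ℕ) * d) :
    ∃ (d b : ℤ) (σ : Equiv.Perm (Fin n)), IsDisjointAdjTranspProd σ ∧
        ∀ i : Fin n, a i = b + ((σ i : ℕ) : ℤ) * d := by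
  have hdich : (∀ v w : Fin n, (v:ℕ) + 2 ≤ w → p v < p w) ∨
      (∀ v w : Fin n, (v:ℕ) + 2 ≤ w → p w < p v) := by
    by_cases hamb : d ∈ diffSet a ∧ -d ∈ diffSet a
    · apply far_dich hn
      intro k hk
      by_cases hkn : n ≤ k
      · left
        intro v w e
        omega
      have un : ¬ ((k:ℤ) * d ∈ diffSet a ∧ -((k:ℤ) * d) ∈ diffSet a) := by
        intro hc
        have := card_amb' a d hd (Finset.Icc 1 ((n:ℤ) - 1)) {1, (k:ℤ)} (by
            intro x hx
            simp only [Finset.mem_insert, Finset.mem_singleton] at hx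
            rw [Finset.mem_Icc]
            omega) (by
            intro m hm
            rw [Finset.mem_Icc] at hm
            refine ⟨by omega, p ⟨0, by omega⟩, p ⟨m.toNat, by omega⟩, ?_⟩
            rw [h, h]
            have : ((m.toNat : ℕ) : ℤ) = m := by omega
            simp [this]) (by
            intro m hm
            simp only [Finset.mem_insert, Finset.mem_singleton] at hm
            rcases hm with rfl | rfl
            · simpa using hamb
            · exact hc)
        rw [Finset.card_pair (by omega), Int.card_Icc] at this
        omega
      rcases sign_def a p _ (mul_pos (by omega) hd) un with s | s
      · left
        intro v w e
        exact s v w (by rw [h, h, e]; push_cast; ring)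
      · right
        intro v w e
        exact s v w (by rw [h, h, e]; push_cast; ring)
    · rcases sign_def a p d hd hamb with s | s
      · left
        have := consec_mono p (fun v w e => s v w (by rw [h, h, e]; push_cast; ring))
        exact fun v w e => this v w (Fin.lt_def.mpr (by omega))
      · right
        have := consec_mono (p.trans Fin.revPerm) (fun v w e => by
          simpa using s v w (by rw [h, h, e]; push_cast; ring))
        intro v w e
        simpa using this v w (Fin.lt_def.mpr (by omega))
  rcases hdich with s | s
  · have hp := near_id p s
    refine ⟨d, c, p, hp, fun i => ?_⟩
    have := h (p i)
    rwa [show p (p i) = i from Equiv.congr_fun hp.1 i] at this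
  · have hp := near_id (Fin.revPerm.trans p) (fun v w e => by
      have hv := v.2
      have hw := w.2
      simpa using s (Fin.rev w) (Fin.rev v) (by rw [Fin.val_rev, Fin.val_rev]; omega))
    refine ⟨-d, c + ((n:ℤ) - 1) * d, _, hp, fun i => ?_⟩
    have h2 := h (Fin.rev ((Fin.revPerm.trans p) i))
    have h3 : p (Fin.rev ((Fin.revPerm.trans p) i)) = i := Equiv.congr_fun hp.1 i
    rw [h3] at h2
    rw [h2, Fin.val_rev]
    have := ((Fin.revPerm.trans p) i).2
    rw [Nat.cast_sub (by omega)]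
    push_cast
    ring

theorem type1_case {n : ℕ} (hn : 5 ≤ n) (a : Fin n → ℤ) (hcard : (diffSet a).card = n)
    (p : Equiv.Perm (Fin n)) (c d : ℤ) (hd : 0 < d) (k : ℕ) (hk1 : 1 ≤ k) (hk2 : k ≤ n - 1)
    (h : ∀ v : Fin n, a (p v) = c + (if (v:ℕ) < k then ((v:ℕ):ℤ) else ((v:ℕ):ℤ) + 1) * d) :
    (∀ v, p v = v) ∨ (∀ v, p v = Fin.rev v) := by
  have hlo : ∀ v : Fin n, (v:ℕ) < k → a (p v) = c + ((v:ℕ):ℤ) * d := by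
    intro v hv; rw [h, if_pos hv]
  have hhi : ∀ v : Fin n, ¬ (v:ℕ) < k → a (p v) = c + (((v:ℕ):ℤ) + 1) * d := by
    intro v hv; rw [h, if_neg hv]
  -- the point with value m, m ≠ k
  have hval : ∀ m : ℕ, m ≤ n → m ≠ k → ∃ v, a (p v) = c + (m:ℤ) * d := by
    intro m hm hmk
    by_cases hlt : m < k
    · exact ⟨⟨m, by omega⟩, hlo ⟨m, by omega⟩ hlt⟩
    · refine ⟨⟨m - 1, by omega⟩, ?_⟩
      rw [hhi ⟨m - 1, by omega⟩ (by simp only; omega)]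
      simp only
      rw [Nat.cast_sub (by omega)]
      push_cast; ring
  have hdiff : ∀ m l : ℕ, m + l ≤ n → m ≠ k → m + l ≠ k → ∃ i j, a (p j) - a (p i) = (l:ℤ) * d := by
    intro m l h1 h2 h3
    obtain ⟨i, hi⟩ := hval m (by omega) h2
    obtain ⟨j, hj⟩ := hval (m + l) h1 h3
    exact ⟨i, j, by rw [hi, hj]; push_cast; ring⟩
  have hadj : ∃ m : ℕ, m + 2 ≤ n ∧ m ≠ k ∧ m + 1 ≠ k ∧ m + 2 ≠ k := by
    by_cases h3 : 3 ≤ k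
    · exact ⟨0, by omega, by omega, by omega, by omega⟩
    · exact ⟨k + 1, by omega, by omega, by omega, by omega⟩
  obtain ⟨m, m1, m2, m3, m4⟩ := hadj
  obtain ⟨v0, q0⟩ := hval m (by omega) m2
  obtain ⟨v1, q1⟩ := hval (m+1) (by omega) m3
  obtain ⟨v2, q2⟩ := hval (m+2) (by omega) m4
  refine gap_mono a hcard p d hd (Finset.Icc 1 (n:ℤ)) (by simp) (by simp; omega) (by simp; omega)
    ?_ ?_ v0 v1 v2 (by rw [q0, q1]; push_cast; ring) (by rw [q1, q2]; push_cast; ring)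
  · intro l hl
    rw [Finset.mem_Icc] at hl
    refine ⟨by omega, ?_⟩
    obtain ⟨l, rfl⟩ : ∃ l' : ℕ, l = l' := ⟨l.toNat, by omega⟩
    by_cases hlk : l = k
    · by_cases hk : k = 1
      · exact hdiff 2 l (by omega) (by omega) (by omega)
      · exact hdiff 1 l (by omega) (by omega) (by omega)
    · exact hdiff 0 l (by omega) (by omega) (by omega)
  · intro v w e
    by_cases hw : (w:ℕ) < k
    · left; rw [hlo w hw, hlo v (by omega), e]; push_cast; ring
    · by_cases hv : (v:ℕ) < k
      · right; rw [hhi w hw, hlo v hv, e]; push_cast; ring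
      · left; rw [hhi w hw, hhi v hv, e]; push_cast; ring

theorem type2_case {n : ℕ} (hn : 5 ≤ n) (a : Fin n → ℤ) (hcard : (diffSet a).card = n)
    (p : Equiv.Perm (Fin n)) (c d : ℤ) (hd : 0 < d)
    (h : ∀ v : Fin n, a (p v) = c + (if (v:ℕ) = 0 then (0:ℤ) else
      if (v:ℕ) = n - 1 then (n:ℤ) + 1 else ((v:ℕ):ℤ) + 1) * d) :
    (∀ v, p v = v) ∨ (∀ v, p v = Fin.rev v) := by
  have h0 : ∀ v : Fin n, (v:ℕ) = 0 → a (p v) = c := by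
    intro v hv; rw [h, if_pos hv]; ring
  have hl : ∀ v : Fin n, (v:ℕ) = n - 1 → a (p v) = c + ((n:ℤ) + 1) * d := by
    intro v hv; rw [h, if_neg (by omega), if_pos hv]
  have hm : ∀ v : Fin n, (v:ℕ) ≠ 0 → (v:ℕ) ≠ n - 1 → a (p v) = c + (((v:ℕ):ℤ) + 1) * d := by
    intro v hv hv'; rw [h, if_neg hv, if_neg hv']
  have q1 := hm ⟨1, by omega⟩ (by simp) (by simp only; omega)
  have q2 := hm ⟨2, by omega⟩ (by simp) (by simp only; omega)
  have q3 := hm ⟨3, by omega⟩ (by simp) (by simp only; omega)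
  refine gap_mono a hcard p d hd (insert ((n:ℤ)+1) (Finset.Icc 1 ((n:ℤ)-1))) ?_ (by simp; omega)
    (by simp; omega) ?_ ?_ ⟨1, by omega⟩ ⟨2, by omega⟩ ⟨3, by omega⟩
    (by rw [q1, q2]; push_cast; ring) (by rw [q2, q3]; push_cast; ring)
  · rw [Finset.card_insert_of_notMem (by simp), Int.card_Icc]; omega
  · intro l hl'
    rw [Finset.mem_insert, Finset.mem_Icc] at hl'
    refine ⟨by omega, ?_⟩
    rcases hl' with rfl | hl'
    · refine ⟨⟨0, by omega⟩, ⟨n-1, by omega⟩, ?_⟩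
      rw [hl _ rfl, h0 _ rfl]; ring
    · by_cases hl1 : l = 1
      · exact ⟨⟨1, by omega⟩, ⟨2, by omega⟩, by rw [q1, q2, hl1]; push_cast; ring⟩
      · refine ⟨⟨0, by omega⟩, ⟨l.toNat - 1, by omega⟩, ?_⟩
        rw [hm _ (by simp only; omega) (by simp only; omega), h0 _ rfl]
        have : ((l.toNat - 1 : ℕ) : ℤ) = l - 1 := by omega
        simp only [this]
        ring
  · intro v w e
    by_cases hv : (v:ℕ) = 0
    · right
      rw [hm w (by omega) (by omega), h0 v hv, e, hv]; push_cast; ring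
    · by_cases hw : (w:ℕ) = n - 1
      · right
        rw [hl w hw, hm v hv (by omega)]
        have : (n:ℤ) = (v:ℕ) + 2 := by omega
        rw [this]; ring
      · left
        rw [hm w (by omega) hw, hm v hv (by omega), e]; push_cast; ring

theorem stmt0 {n : ℕ} (hn : 5 ≤ n) (a : Fin n → ℤ)
    (hinj : Function.Injective a)
    (hcard : (diffSet a).card = n) :
    ∃ d : ℤ,
      -- type (1): the AP `a 0, a 0 + d, …, a 0 + n•d` with the term `a 0 + k•d` omitted
      (∃ k : ℕ, 1 ≤ k ∧ k ≤ n - 1 ∧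
        ∀ i : Fin n, a i = a ⟨0, by omega⟩ +
          (if (i : ℕ) < k then ((i : ℕ) : ℤ) else ((i : ℕ) : ℤ) + 1) * d) ∨
      -- type (2): `a 0, a 0 + 2d, a 0 + 3d, …, a 0 + (n-1)d, a 0 + (n+1)d`
      (∀ i : Fin n, a i = a ⟨0, by omega⟩ +
        (if (i : ℕ) = 0 then (0 : ℤ)
          else if (i : ℕ) = n - 1 then (n : ℤ) + 1 else ((i : ℕ) : ℤ) + 1) * d) ∨
      -- type (3): a product of disjoint adjacent transpositions applied to an AP
      (∃ (b : ℤ) (σ : Equiv.Perm (Fin n)), IsDisjointAdjTranspProd σ ∧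
        ∀ i : Fin n, a i = b + ((σ i : ℕ) : ℤ) * d) := by
  have hsm : StrictMono (a ∘ Tuple.sort a) :=
    (Tuple.monotone_sort a).strictMono_of_injective (hinj.comp (Tuple.sort a).injective)
  generalize Tuple.sort a = p at hsm
  have hss := sorted_struct n hn (fun i => if h : i < n then a (p ⟨i, h⟩) else 0)
    ((diffSet a).image (fun x => |x|)) (by
      intro i j hij hj
      have hi : i < n := by omega
      simp only [hi, hj, dite_true]
      exact hsm (show (⟨i, hi⟩ : Fin n) < ⟨j, hj⟩ from hij)) (by
      intro i j hij hj
      have hi : i < n := by omega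
      simp only [hi, hj, dite_true]
      have hlt : a (p ⟨i, hi⟩) < a (p ⟨j, hj⟩) := hsm (show (⟨i, hi⟩ : Fin n) < ⟨j, hj⟩ from hij)
      rw [Finset.mem_image]
      rcases mem_or a (p ⟨i, hi⟩) (p ⟨j, hj⟩) _ (sub_pos.mpr hlt) rfl with h | h
      · exact ⟨_, h, abs_of_pos (sub_pos.mpr hlt)⟩
      · exact ⟨_, h, by rw [abs_neg]; exact abs_of_pos (sub_pos.mpr hlt)⟩)
    (Finset.card_image_le.trans hcard.le)
  obtain ⟨d, hd, hss⟩ := hss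
  have h0n : 0 < n := by omega
  simp only [h0n, dite_true] at hss
  rcases hss with hss | ⟨k, hk1, hk2, hss⟩ | hss
  · have h : ∀ v : Fin n, a (p v) = a (p ⟨0, h0n⟩) + (v:ℕ) * d := by
      intro v; have := hss v v.2; simpa only [v.2, dite_true, Fin.eta] using this
    obtain ⟨d', b', σ, h1, h2⟩ := ap_case hn a hcard p _ d hd h
    exact ⟨d', Or.inr (Or.inr ⟨b', σ, h1, h2⟩)⟩
  · have h : ∀ v : Fin n, a (p v) = a (p ⟨0, h0n⟩) +
        (if (v:ℕ) < k then ((v:ℕ):ℤ) else ((v:ℕ):ℤ) + 1) * d := by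
      intro v; have := hss v v.2; simpa only [v.2, dite_true, Fin.eta] using this
    rcases type1_case hn a hcard p _ d hd k hk1 hk2 h with hp | hp
    · refine ⟨d, Or.inl ⟨k, hk1, hk2, fun i => ?_⟩⟩
      have := h i
      rwa [hp, hp] at this
    · refine ⟨-d, Or.inl ⟨n - k, by omega, by omega, fun i => ?_⟩⟩
      have e1 := h (Fin.rev i)
      have e2 := h (Fin.rev ⟨0, h0n⟩)
      rw [hp, Fin.rev_rev] at e1 e2
      have hi := i.2
      rw [e1, e2, Fin.val_rev, Fin.val_rev]
      have hn1 : ¬ n - (0 + 1) < k := by omega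
      simp only [hn1, if_false]
      rw [Nat.cast_sub (by omega), Nat.cast_sub (by omega)]
      by_cases hc : (i:ℕ) < n - k
      · rw [if_pos hc, if_neg (by omega)]; push_cast; ring
      · rw [if_neg hc, if_pos (by omega)]; push_cast; ring
  · have h : ∀ v : Fin n, a (p v) = a (p ⟨0, h0n⟩) + (if (v:ℕ) = 0 then (0:ℤ) else
      if (v:ℕ) = n - 1 then (n:ℤ) + 1 else ((v:ℕ):ℤ) + 1) * d := by
      intro v; have := hss v v.2; simpa only [v.2, dite_true, Fin.eta] using this
    rcases type2_case hn a hcard p _ d hd h with hp | hp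
    · refine ⟨d, Or.inr (Or.inl fun i => ?_)⟩
      have := h i
      rwa [hp, hp] at this
    · refine ⟨-d, Or.inr (Or.inl fun i => ?_)⟩
      have e1 := h (Fin.rev i)
      have e2 := h (Fin.rev ⟨0, h0n⟩)
      rw [hp, Fin.rev_rev] at e1 e2
      have hi := i.2
      rw [e1, e2, Fin.val_rev, Fin.val_rev]
      have hn1 : ¬ n - (0 + 1) = 0 := by omega
      have hn2 : n - (0 + 1) = n - 1 := by omega
      simp only [hn1, if_false, hn2, if_true]
      by_cases hc : (i:ℕ) = 0
      · rw [if_pos hc, if_neg (by omega), if_pos (by omega)]; ring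
      · by_cases hc' : (i:ℕ) = n - 1
        · rw [if_neg hc, if_pos hc', if_pos (by omega)]; ring
        · rw [if_neg hc, if_neg hc', if_neg (by omega), if_neg (by omega), Nat.cast_sub (by omega)]
          push_cast; ring
end

section
/- Let n ≥ 5 and let a_1 < a_2 < ⋯ < a_n be integers such that the difference set A = {a_j − a_i : 1 ≤ i < j ≤ n} has cardinality exactly n. Then there exists an integer d > 0 such that either (1) the sequence (a_1, …, a_n) equals the arithmetic progression (a_1, a_1+d, …, a_1+nd) with exactly one term a_1+kd omitted for some 1 ≤ k ≤ n−1, or (2) it equals (a_1, a_1+2d, a_1+3d, …, a_1+(n−1)d, a_1+(n+1)d). -/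
def DD (a : ℕ → ℤ) (n : ℕ) : Finset ℤ :=
  ((Finset.range n ×ˢ Finset.range n).filter fun p => p.1 < p.2).image fun p => a p.2 - a p.1

theorem mem_DD {a : ℕ → ℤ} {n : ℕ} {x : ℤ} :
    x ∈ DD a n ↔ ∃ i j, i < j ∧ j < n ∧ a j - a i = x := by
  simp only [DD, Finset.mem_image, Finset.mem_filter, Finset.mem_product, Finset.mem_range,
    Prod.exists]
  constructor
  · rintro ⟨i, j, ⟨⟨_, h⟩, h2⟩, h3⟩
    exact ⟨i, j, h2, h, h3⟩
  · rintro ⟨i, j, h1, h2, h3⟩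
    exact ⟨i, j, ⟨⟨by omega, h2⟩, h1⟩, h3⟩

def SM (a : ℕ → ℤ) (n : ℕ) : Prop := ∀ i j, i < j → j < n → a i < a j

theorem SM.le {a : ℕ → ℤ} {n : ℕ} (h : SM a n) {i j : ℕ} (hij : i ≤ j) (hj : j < n) :
    a i ≤ a j := by
  rcases hij.eq_or_lt with rfl | h'
  · exact le_rfl
  · exact (h i j h' hj).le

theorem SM.pred {a : ℕ → ℤ} {n : ℕ} (h : SM a (n+1)) : SM a n :=
  fun i j h1 h2 => h i j h1 (by omega)

theorem DD_sub (a : ℕ → ℤ) (n : ℕ) : DD a n ⊆ DD a (n+1) := by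
  intro x hx
  rw [mem_DD] at *
  obtain ⟨i, j, h1, h2, h3⟩ := hx
  exact ⟨i, j, h1, by omega, h3⟩

theorem DD_new {a : ℕ → ℤ} {n : ℕ} (h : SM a (n+1)) : a n - a 0 ∉ DD a n := by
  intro hx
  rw [mem_DD] at hx
  obtain ⟨i, j, h1, h2, h3⟩ := hx
  have := h.le (i := 0) (j := i) (by omega) (by omega)
  have := h j n h2 (by omega)
  omega

theorem DD_last {a : ℕ → ℤ} {n i : ℕ} (hi : i < n) : a n - a i ∈ DD a (n+1) :=
  mem_DD.2 ⟨i, n, hi, by omega, rfl⟩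

/-- the new differences not in `DD a n` -/
theorem card_new {a : ℕ → ℤ} {n : ℕ} (S : Finset ℕ) (h : SM a (n+1))
    (hS : ∀ i ∈ S, i < n ∧ a n - a i ∉ DD a n) : (DD a n).card + S.card ≤ (DD a (n+1)).card := by
  have hinj : (S.image fun i => a n - a i).card = S.card := by
    apply Finset.card_image_of_injOn
    intro i hi j hj hij
    have hi' := (hS i hi).1
    have hj' := (hS j hj).1
    simp only at hij
    rcases lt_trichotomy i j with h1 | h1 | h1
    · have := h i j h1 (by omega); omega
    · exact h1
    · have := h j i h1 (by omega); omega
  rw [← hinj, ← Finset.card_union_of_disjoint]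
  · apply Finset.card_le_card
    apply Finset.union_subset (DD_sub a n)
    intro x hx
    obtain ⟨i, hi, rfl⟩ := Finset.mem_image.1 hx
    exact DD_last (hS i hi).1
  · rw [Finset.disjoint_right]
    intro x hx
    obtain ⟨i, hi, rfl⟩ := Finset.mem_image.1 hx
    exact (hS i hi).2

theorem card_succ {a : ℕ → ℤ} {n : ℕ} (hn : 0 < n) (h : SM a (n+1)) :
    (DD a n).card + 1 ≤ (DD a (n+1)).card := by
  have := card_new {0} h (by simp [hn, DD_new h])
  simpa using this

theorem card_lb {a : ℕ → ℤ} {n : ℕ} (hn : 0 < n) (h : SM a n) : n ≤ (DD a n).card + 1 := by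
  induction n with
  | zero => omega
  | succ n ih =>
    rcases Nat.eq_zero_or_pos n with rfl | h0
    · omega
    · have := ih h0 h.pred
      have := card_succ h0 h
      omega

theorem scaled {a : ℕ → ℤ} {n : ℕ} {d : ℤ} (hd : 0 < d) {f : ℕ → ℤ} {i : ℕ} (hi : i < n)
    (hf : ∀ i < n, a i = a 0 + f i * d) (hm : a n - a i ∈ DD a n) :
    ∃ K, a n = a 0 + K * d := by
  obtain ⟨l, j, h1, h2, h3⟩ := mem_DD.1 hm
  refine ⟨f j - f l + f i, ?_⟩
  have e1 := hf i hi
  have e2 := hf j h2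
  have e3 := hf l (by omega)
  linear_combination -h3 + e1 + e2 - e3

theorem scaled2 {a : ℕ → ℤ} {n : ℕ} {d : ℤ} (hd : 0 < d) {f : ℕ → ℤ} {i : ℕ} (hi : i < n)
    (hf : ∀ i < n, a i = a 0 + f i * d) {K : ℤ} (hK : a n = a 0 + K * d) (hm : a n - a i ∈ DD a n) :
    ∃ l j, l < j ∧ j < n ∧ K = f i + f j - f l := by
  obtain ⟨l, j, h1, h2, h3⟩ := mem_DD.1 hm
  refine ⟨l, j, h1, h2, ?_⟩
  have e1 := hf i hi
  have e2 := hf j h2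
  have e3 := hf l (by omega)
  apply mul_right_cancel₀ hd.ne'
  linear_combination -h3 + e1 + e2 - e3 - hK

theorem scaled_lt {a : ℕ → ℤ} {n : ℕ} {d : ℤ} (hd : 0 < d) {f : ℕ → ℤ} {i : ℕ} (hi : i < n)
    (h : SM a (n+1))
    (hf : ∀ i < n, a i = a 0 + f i * d) {K : ℤ} (hK : a n = a 0 + K * d) : f i < K := by
  have := h i n hi (by omega)
  rw [hf i hi, hK] at this
  exact lt_of_mul_lt_mul_right (by linarith) hd.le

theorem ap {a : ℕ → ℤ} {n : ℕ} (hn : 2 ≤ n) (h : SM a n) (hc : (DD a n).card + 1 ≤ n) :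
    ∃ d : ℤ, 0 < d ∧ ∀ i < n, a i = a 0 + (i : ℤ) * d := by
  induction n, hn using Nat.le_induction with
  | base =>
    refine ⟨a 1 - a 0, by have := h 0 1 (by omega) (by omega); omega, ?_⟩
    intro i hi
    interval_cases i <;> simp
  | succ n hn ih =>
    have h1 := card_succ (by omega) h
    obtain ⟨d, hd, hf⟩ := ih h.pred (by omega)
    have h2 : a n - a 1 ∈ DD a n := by
      by_contra hx
      have := card_new {0, 1} h (by
        intro i hi
        simp at hi
        rcases hi with rfl | rfl
        · exact ⟨by omega, DD_new h⟩
        · exact ⟨by omega, hx⟩)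
      have := card_lb (by omega) h.pred
      simp at *
      omega
    obtain ⟨K, hK⟩ := scaled (f := fun i => (i : ℤ)) hd (by omega) hf h2
    obtain ⟨l, j, h3, h4, h5⟩ := scaled2 (f := fun i => (i : ℤ)) hd (by omega) hf hK h2
    have h6 := scaled_lt (f := fun i => (i : ℤ)) (i := n-1) hd (by omega) h hf hK
    beta_reduce at h5 h6
    refine ⟨d, hd, ?_⟩
    intro i hi
    rcases Nat.lt_succ_iff_lt_or_eq.1 hi with h' | rfl
    · exact hf i h'
    · rw [hK]
      have : K = i := by omega
      rw [this]

def f1 (k i : ℕ) : ℤ := if i < k then (i : ℤ) else (i : ℤ) + 1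
def f2 (n i : ℕ) : ℤ := if i = 0 then (0 : ℤ) else if i = n - 1 then (n : ℤ) + 1 else (i : ℤ) + 1

def PP (a : ℕ → ℤ) (n : ℕ) : Prop := ∃ d : ℤ, 0 < d ∧
  ((∃ k : ℕ, 1 ≤ k ∧ k ≤ n - 1 ∧ ∀ i < n, a i = a 0 + f1 k i * d) ∨
    ∀ i < n, a i = a 0 + f2 n i * d)

set_option maxHeartbeats 2000000 in
theorem base_alg (x y z w v : ℤ) (hx : 0 < x) (hy : 0 < y) (hz : 0 < z) (hw : 0 < w)
    (S : Finset ℤ) (hS : S = {v, x, x+y, x+y+z, x+y+z+w})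
    (hv : v = y ∨ v = z ∨ v = w ∨ v = y + z ∨ v = z + w ∨ v = y+z+w)
    (hvx : v ≠ x) (hvy : v ≠ x + y) (hvz : v ≠ x+y+z) (hvw : v ≠ x+y+z+w)
    (m1 : y ∈ S) (m2 : z ∈ S) (m3 : w ∈ S) (m4 : y+z ∈ S) (m5 : z+w ∈ S) (m6 : y+z+w ∈ S) :
    (x = 2*y ∧ z = y ∧ w = y) ∨ (y = 2*x ∧ z = x ∧ w = x) ∨ (z = 2*x ∧ y = x ∧ w = x) ∨
    (w = 2*x ∧ y = x ∧ z = x) ∨ (x = 2*y ∧ z = y ∧ w = 2*y) := by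
  have hS' : ∀ t ∈ S, t = v ∨ t = x ∨ t = x+y ∨ t = x+y+z ∨ t = x+y+z+w := by
    intro t ht
    simpa [hS] using ht
  clear hS
  rcases hv with h | h | h | h | h | h <;>
  rcases hS' _ m6 with h6 | h6 | h6 | h6 | h6 <;> (try (exfalso; omega)) <;>
  rcases hS' _ m4 with h4 | h4 | h4 | h4 | h4 <;> (try (exfalso; omega)) <;>
  rcases hS' _ m5 with h5 | h5 | h5 | h5 | h5 <;> (try (exfalso; omega)) <;>
  rcases hS' _ m1 with h1 | h1 | h1 | h1 | h1 <;> (try (exfalso; omega)) <;>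
  rcases hS' _ m2 with h2 | h2 | h2 | h2 | h2 <;> (try (exfalso; omega)) <;>
  rcases hS' _ m3 with h3 | h3 | h3 | h3 | h3 <;> omega

set_option maxHeartbeats 1000000 in
theorem base {a : ℕ → ℤ} (h : SM a 5) (hc : (DD a 5).card = 5) : PP a 5 := by
  have g0 := h 0 1 (by omega) (by omega)
  have g1 := h 1 2 (by omega) (by omega)
  have g2 := h 2 3 (by omega) (by omega)
  have g3 := h 3 4 (by omega) (by omega)
  set C : Finset ℤ := {a 1 - a 0, a 2 - a 0, a 3 - a 0, a 4 - a 0} with hC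
  have hCc : C.card = 4 := by
    rw [hC, Finset.card_insert_of_notMem, Finset.card_insert_of_notMem,
      Finset.card_insert_of_notMem, Finset.card_singleton] <;>
    · simp only [Finset.mem_insert, Finset.mem_singleton]; omega
  have hM : ∀ i j, i < j → j < 5 → a j - a i ∈ DD a 5 := fun i j h1 h2 => mem_DD.2 ⟨i, j, h1, h2, rfl⟩
  have hsub : C ⊆ DD a 5 := by
    intro x hx
    simp only [hC, Finset.mem_insert, Finset.mem_singleton] at hx
    rcases hx with rfl | rfl | rfl | rfl <;> exact hM _ _ (by omega) (by omega)
  obtain ⟨v, hvC, hv⟩ := Finset.exists_eq_insert_iff.2 ⟨hsub, by rw [hCc, hc]⟩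
  have hvD : v ∈ DD a 5 := by rw [← hv]; simp
  have hvC' := hvC
  simp only [hC, Finset.mem_insert, Finset.mem_singleton, not_or] at hvC'
  have key := base_alg (a 1 - a 0) (a 2 - a 1) (a 3 - a 2) (a 4 - a 3) v (by omega) (by omega)
    (by omega) (by omega) (DD a 5) (by
      rw [← hv, hC]
      ext t
      simp only [Finset.mem_insert, Finset.mem_singleton]
      rw [show a 1 - a 0 + (a 2 - a 1) = a 2 - a 0 by ring,
        show a 2 - a 0 + (a 3 - a 2) = a 3 - a 0 by ring,
        show a 3 - a 0 + (a 4 - a 3) = a 4 - a 0 by ring])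
    (by
      obtain ⟨i, j, h1, h2, h3⟩ := mem_DD.1 hvD
      obtain ⟨u1, u2, u3, u4⟩ := hvC'
      clear hvD hM hsub hCc hvC hv
      interval_cases j <;> interval_cases i <;> omega)
    (by omega) (by omega) (by omega) (by omega)
    (hM 1 2 (by omega) (by omega)) (hM 2 3 (by omega) (by omega)) (hM 3 4 (by omega) (by omega))
    (by convert hM 1 3 (by omega) (by omega) using 1; ring)
    (by convert hM 2 4 (by omega) (by omega) using 1; ring)
    (by convert hM 1 4 (by omega) (by omega) using 1; ring)
  rcases key with k | k | k | k | k
  · refine ⟨a 2 - a 1, by omega, Or.inl ⟨1, by omega, by omega, fun i hi => ?_⟩⟩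
    interval_cases i <;> simp [f1] <;> omega
  · refine ⟨a 1 - a 0, by omega, Or.inl ⟨2, by omega, by omega, fun i hi => ?_⟩⟩
    interval_cases i <;> simp [f1] <;> omega
  · refine ⟨a 1 - a 0, by omega, Or.inl ⟨3, by omega, by omega, fun i hi => ?_⟩⟩
    interval_cases i <;> simp [f1] <;> omega
  · refine ⟨a 1 - a 0, by omega, Or.inl ⟨4, by omega, by omega, fun i hi => ?_⟩⟩
    interval_cases i <;> simp [f1] <;> omega
  · refine ⟨a 2 - a 1, by omega, Or.inr fun i hi => ?_⟩
    interval_cases i <;> simp [f2] <;> omega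

theorem main {a : ℕ → ℤ} {n : ℕ} (hn : 5 ≤ n) (h : SM a n) (hc : (DD a n).card = n) : PP a n := by
  induction n, hn using Nat.le_induction with
  | base => exact base h hc
  | succ n hn ih =>
    have h1 := card_succ (by omega) h
    have h2 := card_lb (by omega) h.pred
    rcases (by omega : (DD a n).card = n ∨ (DD a n).card + 1 = n) with h3 | h3
    · have hin : ∀ i, 0 < i → i < n → a n - a i ∈ DD a n := by
        intro i hi hin
        by_contra hx
        have := card_new {0, i} h (by
          intro j hj
          simp at hj
          rcases hj with rfl | rfl
          · exact ⟨by omega, DD_new h⟩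
          · exact ⟨by omega, hx⟩)
        rw [Finset.card_pair (by omega)] at this
        omega
      have m1 := hin 1 (by omega) (by omega)
      have m2 := hin 2 (by omega) (by omega)
      obtain ⟨d, hd, ⟨k, hk1, hk2, hf⟩ | hf⟩ := ih h.pred h3
      · obtain ⟨K, hK⟩ := scaled hd (by omega) hf m1
        obtain ⟨l, j, h4, h5, h6⟩ := scaled2 hd (by omega) hf hK m1
        have h7 := scaled_lt (i := n-1) hd (by omega) h hf hK
        have hcase : K = n + 1 ∨ (K = n + 2 ∧ k = 1) := by
          simp only [f1] at h6 h7
          split_ifs at h6 h7 <;> omega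
        rcases hcase with hc' | ⟨hc', rfl⟩
        · refine ⟨d, hd, Or.inl ⟨k, hk1, by omega, fun i hi => ?_⟩⟩
          rcases Nat.lt_succ_iff_lt_or_eq.1 hi with h' | rfl
          · exact hf i h'
          · rw [hK, hc', f1, if_neg (by omega)]
        · refine ⟨d, hd, Or.inr fun i hi => ?_⟩
          have : a i = a 0 + (if i = n then K else f1 1 i) * d := by
            split_ifs with h'
            · rw [h', hK]
            · exact hf i (by omega)
          rw [this]
          congr 2
          simp only [f1, f2]
          split_ifs <;> push_cast <;> omega
      · exfalso
        obtain ⟨K, hK⟩ := scaled hd (by omega) hf m1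
        obtain ⟨l, j, h4, h5, h6⟩ := scaled2 hd (by omega) hf hK m1
        obtain ⟨l', j', h4', h5', h6'⟩ := scaled2 hd (by omega) hf hK m2
        have h7 := scaled_lt (i := n-1) hd (by omega) h hf hK
        have e1 : f2 n 1 = 2 := by rw [f2, if_neg (by omega), if_neg (by omega)]; norm_num
        have e2 : f2 n 2 = 3 := by rw [f2, if_neg (by omega), if_neg (by omega)]; norm_num
        have e3 : f2 n (n-1) = n + 1 := by rw [f2, if_neg (by omega), if_pos rfl]
        rw [e1] at h6
        rw [e2] at h6'
        rw [e3] at h7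
        have q1 : f2 n j - f2 n l = n + 1 ∨ f2 n j - f2 n l < n := by
          simp only [f2]; split_ifs <;> omega
        have q2 : f2 n j' - f2 n l' = n + 1 ∨ f2 n j' - f2 n l' < n := by
          simp only [f2]; split_ifs <;> omega
        omega
    · obtain ⟨d, hd, hf⟩ := ap (by omega) h.pred (by omega)
      have : ∃ i, i < 3 ∧ a n - a i ∈ DD a n := by
        by_contra hx
        push Not at hx
        have := card_new (Finset.range 3) h (by
          intro i hi
          rw [Finset.mem_range] at hi
          exact ⟨by omega, hx i hi⟩)
        simp at this
        omega
      obtain ⟨i, hi, m⟩ := this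
      obtain ⟨K, hK⟩ := scaled (f := fun i => (i : ℤ)) hd (by omega) hf m
      obtain ⟨l, j, h4, h5, h6⟩ := scaled2 (f := fun i => (i : ℤ)) hd (by omega) hf hK m
      have h7 := scaled_lt (f := fun i => (i : ℤ)) (i := n-1) hd (by omega) h hf hK
      beta_reduce at h6 h7
      have hall : ∀ i < n + 1, a i = a 0 + (if i = n then K else i) * d := by
        intro i hi
        split_ifs with h'
        · rw [h', hK]
        · exact hf i (by omega)
      rcases (by omega : K = n ∨ K = n + 1) with hc' | hc'
      · exfalso
        have hs : DD a (n+1) ⊆ (Finset.Icc (1:ℤ) n).image (fun t => t * d) := by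
          intro x hx
          obtain ⟨l, j, h1, h2, h3⟩ := mem_DD.1 hx
          rw [Finset.mem_image]
          refine ⟨(j : ℤ) - l, by rw [Finset.mem_Icc]; omega, ?_⟩
          have e : ∀ i < n + 1, a i = a 0 + i * d := by
            intro i hi
            rw [hall i hi]
            split_ifs with h'
            · rw [hc', h']
            · rfl
          rw [← h3, e j h2, e l (by omega)]
          ring
        have := (Finset.card_le_card hs).trans Finset.card_image_le
        simp at this
        omega
      · refine ⟨d, hd, Or.inl ⟨n, by omega, by omega, fun i hi => ?_⟩⟩
        rw [hall i hi]
        congr 2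
        simp only [f1]
        split_ifs <;> omega


theorem stmt1 {n : ℕ} (hn : 5 ≤ n) (a : Fin n → ℤ)
    (hmono : StrictMono a)
    (hcard : (diffSet a).card = n) :
    ∃ d : ℤ, 0 < d ∧
      -- type (1): the AP `a 0, a 0 + d, …, a 0 + n•d` with the term `a 0 + k•d` omitted
      ((∃ k : ℕ, 1 ≤ k ∧ k ≤ n - 1 ∧
        ∀ i : Fin n, a i = a ⟨0, by omega⟩ +
          (if (i : ℕ) < k then ((i : ℕ) : ℤ) else ((i : ℕ) : ℤ) + 1) * d) ∨
      -- type (2): `a 0, a 0 + 2d, a 0 + 3d, …, a 0 + (n-1)d, a 0 + (n+1)d`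
      (∀ i : Fin n, a i = a ⟨0, by omega⟩ +
        (if (i : ℕ) = 0 then (0 : ℤ)
          else if (i : ℕ) = n - 1 then (n : ℤ) + 1 else ((i : ℕ) : ℤ) + 1) * d)) := by
  have h0 : 0 < n := by omega
  set b : ℕ → ℤ := fun i => if h : i < n then a ⟨i, h⟩ else 0 with hb
  have hba : ∀ i : Fin n, b i = a i := fun i => by simp [hb]
  have hb0 : b 0 = a ⟨0, h0⟩ := by simp [hb, h0]
  have hsm : SM b n := by
    intro i j hij hj
    have := hmono (show (⟨i, by omega⟩ : Fin n) < ⟨j, hj⟩ from hij)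
    rwa [← hba, ← hba] at this
  have hD : DD b n = diffSet a := by
    ext x
    rw [mem_DD]
    simp only [diffSet, Finset.mem_image, Finset.mem_filter, Finset.mem_univ, true_and, Prod.exists]
    constructor
    · rintro ⟨i, j, h1, h2, h3⟩
      refine ⟨⟨i, by omega⟩, ⟨j, h2⟩, h1, ?_⟩
      rw [← hba, ← hba]
      exact h3
    · rintro ⟨i, j, h1, h2⟩
      refine ⟨i, j, h1, j.2, ?_⟩
      rw [hba, hba]
      exact h2
  obtain ⟨d, hd, ⟨k, hk1, hk2, hf⟩ | hf⟩ := main hn hsm (by rw [hD]; exact hcard)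
  · refine ⟨d, hd, Or.inl ⟨k, hk1, hk2, fun i => ?_⟩⟩
    rw [← hba, hf i i.2, hb0]
    rfl
  · refine ⟨d, hd, Or.inr fun i => ?_⟩
    rw [← hba, hf i i.2, hb0]
    rfl
end

section
/- Let a_1, a_2, a_3, a_4 be four distinct integers such that the difference set A = {a_j − a_i : 1 ≤ i < j ≤ 4} has cardinality exactly 4. Then (a_1, a_2, a_3, a_4) is one of the following: (1) (a, a+d, a+2d, a+4d) or (a, a+2d, a+3d, a+4d) for some integers a and d; (2) σ(a, a+d, a+2d, a+3d) for some integer a, some positive integer d, and some permutation σ ≠ id of the four positions; (3) σ(a, a+d, b, b+d) for some integers a, b, a positive integer d with b > a+d, and some permutation σ of the four positions. -/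
theorem sorted_aux (b : Fin 4 → ℤ) (hb : StrictMono b) (i j k l : Fin 4)
    (hij : i ≠ j) (hik : i ≠ k) (hjl : j ≠ l) (hkl : k ≠ l)
    (h : b i + b l = b j + b k) (hil : i ≠ l) (hjk : j ≠ k) : b 0 + b 3 = b 1 + b 2 := by
  have h1 : b 0 < b 1 := hb (by decide)
  have h2 : b 1 < b 2 := hb (by decide)
  have h3 : b 2 < b 3 := hb (by decide)
  fin_cases i <;> fin_cases j <;> simp at hij <;> fin_cases k <;> simp at hik hjk <;>
    fin_cases l <;> simp at hil hjl hkl <;> simp at h <;> omega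

theorem type_three (a : Fin 4 → ℤ) (hinj : Function.Injective a) (i j k l : Fin 4)
    (hij : i ≠ j) (hik : i ≠ k) (hil : i ≠ l) (hjk : j ≠ k) (hjl : j ≠ l) (hkl : k ≠ l)
    (h : a i + a l = a j + a k) :
    ∃ (a₀ b d : ℤ) (σ : Equiv.Perm (Fin 4)), 0 < d ∧ a₀ + d < b ∧
      ∀ i, a i = ![a₀, a₀ + d, b, b + d] (σ i) := by
  have hm : StrictMono (a ∘ Tuple.sort a) :=
    (Tuple.monotone_sort a).strictMono_of_injective (hinj.comp (Tuple.sort a).injective)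
  generalize Tuple.sort a = τ at hm
  have hs := sorted_aux _ hm (τ.symm i) (τ.symm j) (τ.symm k) (τ.symm l)
    (by simpa using hij) (by simpa using hik) (by simpa using hjl) (by simpa using hkl)
    (by simpa using h) (by simpa using hil) (by simpa using hjk)
  have h1 : a (τ 0) < a (τ 1) := hm (by decide)
  have h2 : a (τ 1) < a (τ 2) := hm (by decide)
  simp only [Function.comp] at hs
  refine ⟨a (τ 0), a (τ 2), a (τ 1) - a (τ 0), τ.symm, by omega, by omega, fun m => ?_⟩
  obtain ⟨n, rfl⟩ := τ.surjective m
  rw [Equiv.symm_apply_apply]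
  fin_cases n <;> simp <;> omega

theorem diffSet_four (a : Fin 4 → ℤ) : diffSet a =
    {a 1 - a 0, a 2 - a 0, a 3 - a 0, a 2 - a 1, a 3 - a 1, a 3 - a 2} := by
  have : (Finset.univ.filter fun p : Fin 4 × Fin 4 => p.1 < p.2) =
    {(0,1),(0,2),(0,3),(1,2),(1,3),(2,3)} := by decide
  rw [diffSet, this]
  simp [Finset.image_insert]

theorem stmt2 (a : Fin 4 → ℤ) (hinj : Function.Injective a)
    (hcard : (diffSet a).card = 4) :
    -- type (1): `(a₀, a₀+d, a₀+2d, a₀+4d)` or `(a₀, a₀+2d, a₀+3d, a₀+4d)`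
    (∃ a₀ d : ℤ,
      a = ![a₀, a₀ + d, a₀ + 2 * d, a₀ + 4 * d] ∨
      a = ![a₀, a₀ + 2 * d, a₀ + 3 * d, a₀ + 4 * d]) ∨
    -- type (2): a nontrivial permutation of `(a₀, a₀+d, a₀+2d, a₀+3d)` with `d > 0`
    (∃ (a₀ d : ℤ) (σ : Equiv.Perm (Fin 4)), 0 < d ∧ σ ≠ 1 ∧
      ∀ i, a i = ![a₀, a₀ + d, a₀ + 2 * d, a₀ + 3 * d] (σ i)) ∨
    -- type (3): a permutation of `(a₀, a₀+d, b, b+d)` with `d > 0` and `b > a₀ + d`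
    (∃ (a₀ b d : ℤ) (σ : Equiv.Perm (Fin 4)), 0 < d ∧ a₀ + d < b ∧
      ∀ i, a i = ![a₀, a₀ + d, b, b + d] (σ i)) := by
  by_cases e1 : a 0 + a 3 = a 1 + a 2
  · exact Or.inr (Or.inr (type_three a hinj 0 1 2 3 (by decide) (by decide) (by decide)
      (by decide) (by decide) (by decide) e1))
  by_cases e2 : a 0 + a 2 = a 1 + a 3
  · exact Or.inr (Or.inr (type_three a hinj 0 1 3 2 (by decide) (by decide) (by decide)
      (by decide) (by decide) (by decide) e2))
  by_cases e3 : a 0 + a 1 = a 2 + a 3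
  · exact Or.inr (Or.inr (type_three a hinj 0 2 3 1 (by decide) (by decide) (by decide)
      (by decide) (by decide) (by decide) e3))
  left
  have n01 : a 0 ≠ a 1 := hinj.ne (by decide)
  have n02 : a 0 ≠ a 2 := hinj.ne (by decide)
  have n03 : a 0 ≠ a 3 := hinj.ne (by decide)
  have n12 : a 1 ≠ a 2 := hinj.ne (by decide)
  have n13 : a 1 ≠ a 3 := hinj.ne (by decide)
  have n23 : a 2 ≠ a 3 := hinj.ne (by decide)
  have key : (a 2 - a 1 = a 1 - a 0 ∧ a 3 - a 2 = a 2 - a 0) ∨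
      (a 3 - a 1 = a 1 - a 0 ∧ a 3 - a 2 = a 2 - a 1) := by
    rw [diffSet_four] at hcard
    simp only [Finset.card_insert_eq_ite, Finset.mem_insert, Finset.mem_singleton,
      Finset.card_singleton] at hcard
    split_ifs at hcard <;> omega
  rcases key with ⟨h1, h2⟩ | ⟨h1, h2⟩
  · refine ⟨a 0, a 1 - a 0, Or.inl ?_⟩
    funext i
    fin_cases i <;> simp <;> omega
  · refine ⟨a 0, a 3 - a 2, Or.inr ?_⟩
    funext i
    fin_cases i <;> simp <;> omega
end

section
/- Let n ≥ 2, let d be a positive integer, and let (a_1, …, a_n) be a permutation of the arithmetic progression (b, b+d, …, b+(n−1)d) for some integer b. Let A = {a_j − a_i : 1 ≤ i < j ≤ n} be its difference set. Then for every integer k ≥ 2: if kd ∈ A then d ∈ A, and if −kd ∈ A then −d ∈ A. -/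
theorem stmt4 {n : ℕ} (hn : 2 ≤ n) (d : ℤ) (hd : 0 < d) (a : Fin n → ℤ)
    (hperm : ∃ (b : ℤ) (σ : Equiv.Perm (Fin n)),
      ∀ i : Fin n, a i = b + ((σ i : ℕ) : ℤ) * d) :
    ∀ k : ℤ, 2 ≤ k →
      (k * d ∈ diffSet a → d ∈ diffSet a) ∧
      (-(k * d) ∈ diffSet a → -d ∈ diffSet a) := by
  obtain ⟨b, σ, hσ⟩ := hperm
  obtain ⟨m, rfl⟩ : ∃ m, n = m + 1 := ⟨n - 1, by omega⟩
  have mem : ∀ x : ℤ, x ∈ diffSet a ↔ ∃ i j : Fin (m + 1), i < j ∧ a j - a i = x := by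
    intro x
    simp [diffSet]
  intro k hk
  have hkd : 0 < k * d := by positivity
  constructor
  · intro h
    by_contra hc
    have anti : StrictAnti σ.symm := by
      rw [Fin.strictAnti_iff_succ_lt]
      intro i
      by_contra hlt
      have hne : σ.symm i.castSucc ≠ σ.symm i.succ := by
        intro e
        exact (Fin.castSucc_lt_succ (i := i)).ne (σ.symm.injective e)
      apply hc
      rw [mem]
      refine ⟨_, _, lt_of_le_of_ne (not_lt.mp hlt) hne, ?_⟩
      simp [hσ]
      ring
    obtain ⟨i, j, hij, he⟩ := (mem _).1 h
    have hs : σ i < σ j := by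
      rw [hσ, hσ] at he
      by_contra hle
      have h1 : ((σ j : ℕ) : ℤ) ≤ ((σ i : ℕ) : ℤ) := by exact_mod_cast not_lt.mp hle
      nlinarith
    have := anti hs
    simp at this
    exact absurd this (not_lt.mpr hij.le)
  · intro h
    by_contra hc
    have mono : StrictMono σ.symm := by
      rw [Fin.strictMono_iff_lt_succ]
      intro i
      by_contra hlt
      have hne : σ.symm i.succ ≠ σ.symm i.castSucc := by
        intro e
        exact (Fin.castSucc_lt_succ (i := i)).ne' (σ.symm.injective e)
      apply hc
      rw [mem]
      refine ⟨_, _, lt_of_le_of_ne (not_lt.mp hlt) hne, ?_⟩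
      simp [hσ]
      ring
    obtain ⟨i, j, hij, he⟩ := (mem _).1 h
    have hs : σ j < σ i := by
      rw [hσ, hσ] at he
      by_contra hle
      have h1 : ((σ i : ℕ) : ℤ) ≤ ((σ j : ℕ) : ℤ) := by exact_mod_cast not_lt.mp hle
      nlinarith
    have := mono hs
    simp at this
    exact absurd this (not_lt.mpr hij.le)
end

section
/- Let n ≥ 5 and let (a_1, …, a_n) be a sequence of distinct integers whose difference set A = {a_j − a_i : 1 ≤ i < j ≤ n} has cardinality exactly n, and suppose that the increasing rearrangement of (a_1, …, a_n) is NOT an arithmetic progression. Then the sequence (a_1, …, a_n) is strictly monotone, i.e. either a_1 < a_2 < ⋯ < a_n or a_1 > a_2 > ⋯ > a_n. -/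
def pdiff (B : Finset ℤ) : Finset ℤ :=
  Finset.image (fun p : ℤ × ℤ => p.2 - p.1) ((B ×ˢ B).filter fun p => p.1 < p.2)

theorem mem_pdiff {B : Finset ℤ} {d : ℤ} :
    d ∈ pdiff B ↔ ∃ x ∈ B, ∃ y ∈ B, x < y ∧ y - x = d := by
  simp only [pdiff, Finset.mem_image, Finset.mem_filter, Finset.mem_product, Prod.exists]
  constructor
  · rintro ⟨x, y, ⟨⟨hx, hy⟩, h⟩, e⟩; exact ⟨x, hx, y, hy, h, e⟩
  · rintro ⟨x, hx, y, hy, h, e⟩; exact ⟨x, y, ⟨⟨hx, hy⟩, h⟩, e⟩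

theorem pdiff_erase_lt {B : Finset ℤ} {m M z : ℤ} (hm : m ∈ B) (hM : M ∈ B) (hlt : m < M)
    (hb : ∀ x ∈ B, m ≤ x ∧ x ≤ M) (hz : z = m ∨ z = M) :
    (pdiff (B.erase z)).card < (pdiff B).card := by
  apply Finset.card_lt_card
  rw [Finset.ssubset_iff_of_subset]
  · refine ⟨M - m, mem_pdiff.2 ⟨m, hm, M, hM, hlt, rfl⟩, ?_⟩
    intro h
    obtain ⟨x, hx, y, hy, h1, h2⟩ := mem_pdiff.1 h
    rw [Finset.mem_erase] at hx hy
    have := hb x hx.2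
    have := hb y hy.2
    have := hx.1
    have := hy.1
    omega
  · intro d hd
    obtain ⟨x, hx, y, hy, h1, h2⟩ := mem_pdiff.1 hd
    exact mem_pdiff.2 ⟨x, Finset.mem_of_mem_erase hx, y, Finset.mem_of_mem_erase hy, h1, h2⟩

theorem exists_minmax {B : Finset ℤ} (h : 2 ≤ B.card) :
    ∃ m ∈ B, ∃ M ∈ B, m < M ∧ ∀ x ∈ B, m ≤ x ∧ x ≤ M := by
  have hne : B.Nonempty := Finset.card_pos.1 (by omega)
  obtain ⟨x, hx, y, hy, hxy⟩ := Finset.one_lt_card.1 h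
  refine ⟨B.min' hne, B.min'_mem hne, B.max' hne, B.max'_mem hne, ?_, fun z hz =>
    ⟨B.min'_le z hz, B.le_max' z hz⟩⟩
  have := B.min'_le x hx
  have := B.min'_le y hy
  have := B.le_max' x hx
  have := B.le_max' y hy
  omega

theorem ap_of_card (n : ℕ) : ∀ B : Finset ℤ, B.card = n + 2 → (pdiff B).card ≤ n + 1 →
    ∃ b d : ℤ, 0 < d ∧ B = (Finset.range (n + 2)).image (fun i : ℕ => b + (i : ℤ) * d) := by
  induction n with
  | zero =>
    intro B hB _
    obtain ⟨m, hm, M, hM, hlt, hb⟩ := exists_minmax (B := B) (by omega)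
    refine ⟨m, M - m, by omega, ?_⟩
    symm
    apply Finset.eq_of_subset_of_card_le
    · intro x hx
      simp only [Finset.mem_image, Finset.mem_range] at hx
      obtain ⟨i, hi, rfl⟩ := hx
      interval_cases i
      · simpa using hm
      · simpa using hM
    · rw [hB, Finset.card_image_of_injective]
      · simp
      · intro i j hij
        have : (i : ℤ) * (M - m) = j * (M - m) := by simpa using hij
        exact_mod_cast mul_right_cancel₀ (by omega) this
  | succ n ih =>
    intro B hB hD
    obtain ⟨m, hm, M, hM, hlt, hb⟩ := exists_minmax (B := B) (by omega)
    have hl := pdiff_erase_lt hm hM hlt hb (Or.inr rfl)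
    obtain ⟨b, d, hd, hE⟩ := ih (B.erase M) (by rw [Finset.card_erase_of_mem hM]; omega) (by omega)
    have hmem : ∀ i : ℕ, i < n + 2 → b + (i : ℤ) * d ∈ B ∧ b + (i : ℤ) * d < M := by
      intro i hi
      have : b + (i : ℤ) * d ∈ B.erase M := by
        rw [hE]; exact Finset.mem_image_of_mem _ (Finset.mem_range.2 hi)
      rw [Finset.mem_erase] at this
      exact ⟨this.2, lt_of_le_of_ne (hb _ this.2).2 this.1⟩
    have hinj : Function.Injective (fun i : ℕ => ((i : ℤ) + 1) * d) := by
      intro i j hij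
      have : (i : ℤ) + 1 = j + 1 := mul_right_cancel₀ hd.ne' hij
      omega
    have h0 := hmem 0 (by omega)
    have h1 := hmem 1 (by omega)
    simp only [Nat.cast_zero, zero_mul, add_zero, Nat.cast_one, one_mul] at h0 h1
    have hDs : insert (M - b) ((Finset.range (n + 1)).image (fun i : ℕ => ((i : ℤ) + 1) * d))
        = pdiff B := by
      apply Finset.eq_of_subset_of_card_le
      · intro x hx
        rw [Finset.mem_insert, Finset.mem_image] at hx
        rcases hx with rfl | ⟨i, hi, rfl⟩
        · exact mem_pdiff.2 ⟨b, h0.1, M, hM, h0.2, rfl⟩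
        · have hi := Finset.mem_range.1 hi
          have h2 := hmem (i + 1) (by omega)
          push_cast at h2
          exact mem_pdiff.2 ⟨b, h0.1, _, h2.1, by nlinarith, by ring⟩
      · rw [Finset.card_insert_of_notMem, Finset.card_image_of_injective _ hinj,
          Finset.card_range]
        · omega
        · intro h
          obtain ⟨i, hi, h⟩ := Finset.mem_image.1 h
          have hi := Finset.mem_range.1 hi
          have h2 := hmem (i + 1) (by omega)
          push_cast at h2
          linarith [h2.2]
    have hx : M - (b + d) ∈ pdiff B := mem_pdiff.2 ⟨_, h1.1, M, hM, h1.2, rfl⟩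
    rw [← hDs, Finset.mem_insert, Finset.mem_image] at hx
    rcases hx with hx | ⟨i, hi, hx⟩
    · omega
    have hi := Finset.mem_range.1 hi
    have hin : i = n := by
      by_contra hne
      have h2 := (hmem (i + 2) (by omega)).2
      push_cast at h2
      linarith
    subst hin
    refine ⟨b, d, hd, ?_⟩
    rw [Finset.range_add_one, Finset.image_insert, ← hE]
    have : b + ((i + 2 : ℕ) : ℤ) * d = M := by push_cast; linarith
    show B = insert (b + ((i + 2 : ℕ) : ℤ) * d) _
    rw [this, Finset.insert_erase hM]

set_option maxHeartbeats 4000000 in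
theorem gaps (g1 g2 g3 g4 α : ℤ) (p1 : 0 < g1) (p2 : 0 < g2) (p3 : 0 < g3) (p4 : 0 < g4)
    (H : ∀ x, (x = g4 ∨ x = g3 + g4 ∨ x = g2 + g3 + g4 ∨ x = g2 ∨ x = g3 ∨ x = g2 + g3) →
      x = g1 ∨ x = g1 + g2 ∨ x = g1 + g2 + g3 ∨ x = g1 + g2 + g3 + g4 ∨ x = α) :
    (g2 = g1 ∧ g3 = g1 ∧ g4 = g1) ∨ (g2 = g1 ∧ g3 = g1 ∧ g4 = 2 * g1) ∨
    (g2 = g1 ∧ g3 = 2 * g1 ∧ g4 = g1) ∨ (g2 = 2 * g1 ∧ g3 = g1 ∧ g4 = g1) ∨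
    (g1 = 2 * g2 ∧ g3 = g2 ∧ g4 = g2) ∨ (g1 = 2 * g2 ∧ g3 = g2 ∧ g4 = g1) := by
  rcases H g4 (by simp) with e1 | e1 | e1 | e1 | e1 <;> try (exfalso; omega)
  all_goals rcases H (g3 + g4) (by simp) with e2 | e2 | e2 | e2 | e2 <;> try (exfalso; omega)
  all_goals rcases H (g2 + g3 + g4) (by simp) with e3 | e3 | e3 | e3 | e3 <;> try (exfalso; omega)
  all_goals rcases H g2 (by simp) with e4 | e4 | e4 | e4 | e4 <;> try (exfalso; omega)
  all_goals rcases H g3 (by simp) with e5 | e5 | e5 | e5 | e5 <;> try (exfalso; omega)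
  all_goals rcases H (g2 + g3) (by simp) with e6 | e6 | e6 | e6 | e6 <;> try (exfalso; omega)
  all_goals omega

theorem signs (s : ℤ → Prop) (x0 x1 x2 x3 x4 : ℤ)
    (G : (x2 - x1 = x1 - x0 ∧ x3 - x2 = x1 - x0 ∧ x4 - x3 = x1 - x0) ∨
    (x2 - x1 = x1 - x0 ∧ x3 - x2 = x1 - x0 ∧ x4 - x3 = 2 * (x1 - x0)) ∨
    (x2 - x1 = x1 - x0 ∧ x3 - x2 = 2 * (x1 - x0) ∧ x4 - x3 = x1 - x0) ∨
    (x2 - x1 = 2 * (x1 - x0) ∧ x3 - x2 = x1 - x0 ∧ x4 - x3 = x1 - x0) ∨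
    (x1 - x0 = 2 * (x2 - x1) ∧ x3 - x2 = x2 - x1 ∧ x4 - x3 = x2 - x1) ∨
    (x1 - x0 = 2 * (x2 - x1) ∧ x3 - x2 = x2 - x1 ∧ x4 - x3 = x1 - x0))
    (t1 : s (x1 - x0) → s (x2 - x1) → s (x2 - x0))
    (t2 : s (x2 - x1) → s (x3 - x2) → s (x3 - x1))
    (t3 : s (x3 - x2) → s (x4 - x3) → s (x4 - x2))
    (f1 : ¬ s (x1 - x0) → ¬ s (x2 - x1) → ¬ s (x2 - x0))
    (f2 : ¬ s (x2 - x1) → ¬ s (x3 - x2) → ¬ s (x3 - x1))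
    (f3 : ¬ s (x3 - x2) → ¬ s (x4 - x3) → ¬ s (x4 - x2)) :
    (s (x1 - x0) ∧ s (x2 - x1) ∧ s (x3 - x2) ∧ s (x4 - x3)) ∨
      (¬ s (x1 - x0) ∧ ¬ s (x2 - x1) ∧ ¬ s (x3 - x2) ∧ ¬ s (x4 - x3)) := by
  rcases G with ⟨a, b, c⟩ | ⟨a, b, c⟩ | ⟨a, b, c⟩ | ⟨a, b, c⟩ | ⟨a, b, c⟩ | ⟨a, b, c⟩
  · clear t1 t2 t3 f1 f2 f3
    rw [a, b, c]; tauto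
  · clear t2 t3 f2 f3
    rw [show x2 - x0 = x4 - x3 by omega, a] at t1 f1
    rw [a, b]; tauto
  · clear t2 t3 f2 f3
    rw [show x2 - x0 = x3 - x2 by omega, a] at t1 f1
    rw [a, c]; tauto
  · clear t1 t2 f1 f2
    rw [show x4 - x2 = x2 - x1 by omega, b, c] at t3 f3
    rw [b, c]; tauto
  · clear t1 t3 f1 f3
    rw [show x3 - x1 = x1 - x0 by omega, b] at t2 f2
    rw [b, c]; tauto
  · clear t1 t3 f1 f3
    rw [show x3 - x1 = x1 - x0 by omega, b] at t2 f2
    rw [b, c]; tauto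

set_option maxHeartbeats 1000000 in
theorem base5 (s : ℤ → Prop) (B : Finset ℤ) (hB : B.card = 5) (hD : (pdiff B).card ≤ 5)
    (ht : ∀ x ∈ B, ∀ y ∈ B, ∀ z ∈ B, x < y → y < z → s (y - x) → s (z - y) → s (z - x))
    (hf : ∀ x ∈ B, ∀ y ∈ B, ∀ z ∈ B, x < y → y < z → ¬ s (y - x) → ¬ s (z - y) → ¬ s (z - x)) :
    (∀ x ∈ B, ∀ y ∈ B, x < y → s (y - x)) ∨ (∀ x ∈ B, ∀ y ∈ B, x < y → ¬ s (y - x)) := by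
  set f := B.orderEmbOfFin hB with hfdef
  have hmem : ∀ i, f i ∈ B := fun i => B.orderEmbOfFin_mem hB i
  have hsur : ∀ x ∈ B, ∃ i, f i = x := by
    intro x hx
    have : x ∈ Set.range f := by rw [hfdef, Finset.range_orderEmbOfFin]; exact hx
    exact this
  have hlt : ∀ i j, f i < f j ↔ i < j := fun i j => f.lt_iff_lt
  have l0 := (hlt 0 1).2 (by decide)
  have l1 := (hlt 1 2).2 (by decide)
  have l2 := (hlt 2 3).2 (by decide)
  have l3 := (hlt 3 4).2 (by decide)
  have hd : ∀ i j, i < j → f j - f i ∈ pdiff B := fun i j h =>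
    mem_pdiff.2 ⟨_, hmem i, _, hmem j, (hlt i j).2 h, rfl⟩
  have hP : ({f 1 - f 0, f 2 - f 0, f 3 - f 0, f 4 - f 0} : Finset ℤ) ⊆ pdiff B := by
    intro x hx
    simp only [Finset.mem_insert, Finset.mem_singleton] at hx
    rcases hx with rfl | rfl | rfl | rfl <;> exact hd _ _ (by decide)
  have hPc : ({f 1 - f 0, f 2 - f 0, f 3 - f 0, f 4 - f 0} : Finset ℤ).card = 4 := by
    rw [Finset.card_insert_of_notMem, Finset.card_insert_of_notMem, Finset.card_insert_of_notMem,
      Finset.card_singleton] <;> simp only [Finset.mem_insert, Finset.mem_singleton] <;> omega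
  have hS := Finset.card_sdiff_of_subset hP
  obtain ⟨α, hα⟩ := Finset.card_le_one_iff_subset_singleton.1
    (show (pdiff B \ {f 1 - f 0, f 2 - f 0, f 3 - f 0, f 4 - f 0}).card ≤ 1 by omega)
  have key : ∀ x ∈ pdiff B, x = f 1 - f 0 ∨ x = f 2 - f 0 ∨ x = f 3 - f 0 ∨ x = f 4 - f 0
      ∨ x = α := by
    intro x hx
    by_contra hc
    have : x ∈ pdiff B \ {f 1 - f 0, f 2 - f 0, f 3 - f 0, f 4 - f 0} := by
      simp only [Finset.mem_sdiff, Finset.mem_insert, Finset.mem_singleton]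
      tauto
    have := Finset.mem_singleton.1 (hα this)
    tauto
  have G := gaps (f 1 - f 0) (f 2 - f 1) (f 3 - f 2) (f 4 - f 3) α (by omega) (by omega)
    (by omega) (by omega) (by
      intro x hx
      have hx' : x ∈ pdiff B := by
        rcases hx with rfl | rfl | rfl | rfl | rfl | rfl
        · exact hd 3 4 (by decide)
        · convert hd 2 4 (by decide) using 1; ring
        · convert hd 1 4 (by decide) using 1; ring
        · exact hd 1 2 (by decide)
        · exact hd 2 3 (by decide)
        · convert hd 1 3 (by decide) using 1; ring
      rcases key x hx' with h | h | h | h | h <;> omega)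
  have T : ∀ i j k, i < j → j < k → s (f j - f i) → s (f k - f j) → s (f k - f i) :=
    fun i j k h1 h2 => ht _ (hmem i) _ (hmem j) _ (hmem k) ((hlt _ _).2 h1) ((hlt _ _).2 h2)
  have F : ∀ i j k, i < j → j < k → ¬ s (f j - f i) → ¬ s (f k - f j) → ¬ s (f k - f i) :=
    fun i j k h1 h2 => hf _ (hmem i) _ (hmem j) _ (hmem k) ((hlt _ _).2 h1) ((hlt _ _).2 h2)
  have main : (s (f 1 - f 0) ∧ s (f 2 - f 1) ∧ s (f 3 - f 2) ∧ s (f 4 - f 3)) ∨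
      (¬ s (f 1 - f 0) ∧ ¬ s (f 2 - f 1) ∧ ¬ s (f 3 - f 2) ∧ ¬ s (f 4 - f 3)) := by
    have t1 := T 0 1 2 (by decide) (by decide)
    have t2 := T 1 2 3 (by decide) (by decide)
    have t3 := T 2 3 4 (by decide) (by decide)
    have f1 := F 0 1 2 (by decide) (by decide)
    have f2 := F 1 2 3 (by decide) (by decide)
    have f3 := F 2 3 4 (by decide) (by decide)
    exact signs s _ _ _ _ _ G t1 t2 t3 f1 f2 f3
  rcases main with ⟨m0, m1, m2, m3⟩ | ⟨m0, m1, m2, m3⟩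
  · left
    have a02 := T 0 1 2 (by decide) (by decide) m0 m1
    have a13 := T 1 2 3 (by decide) (by decide) m1 m2
    have a24 := T 2 3 4 (by decide) (by decide) m2 m3
    have a03 := T 0 2 3 (by decide) (by decide) a02 m2
    have a14 := T 1 3 4 (by decide) (by decide) a13 m3
    have a04 := T 0 3 4 (by decide) (by decide) a03 m3
    intro x hx y hy hxy
    obtain ⟨i, rfl⟩ := hsur x hx
    obtain ⟨j, rfl⟩ := hsur y hy
    rw [hlt] at hxy
    clear_value f
    fin_cases i <;> fin_cases j <;> first | assumption | (exfalso; revert hxy; decide)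
  · right
    have a02 := F 0 1 2 (by decide) (by decide) m0 m1
    have a13 := F 1 2 3 (by decide) (by decide) m1 m2
    have a24 := F 2 3 4 (by decide) (by decide) m2 m3
    have a03 := F 0 2 3 (by decide) (by decide) a02 m2
    have a14 := F 1 3 4 (by decide) (by decide) a13 m3
    have a04 := F 0 3 4 (by decide) (by decide) a03 m3
    intro x hx y hy hxy
    obtain ⟨i, rfl⟩ := hsur x hx
    obtain ⟨j, rfl⟩ := hsur y hy
    rw [hlt] at hxy
    clear_value f
    fin_cases i <;> fin_cases j <;> first | assumption | (exfalso; revert hxy; decide)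

theorem allN (s : ℤ → Prop) (n : ℕ) : ∀ B : Finset ℤ, B.card = n + 5 → (pdiff B).card ≤ n + 5 →
    (∀ x ∈ B, ∀ y ∈ B, ∀ z ∈ B, x < y → y < z → s (y - x) → s (z - y) → s (z - x)) →
    (∀ x ∈ B, ∀ y ∈ B, ∀ z ∈ B, x < y → y < z → ¬ s (y - x) → ¬ s (z - y) → ¬ s (z - x)) →
    (∀ x ∈ B, ∀ y ∈ B, x < y → s (y - x)) ∨ (∀ x ∈ B, ∀ y ∈ B, x < y → ¬ s (y - x)) := by
  induction n with
  | zero => intro B hB hD ht hf; exact base5 s B hB hD ht hf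
  | succ n ih =>
    intro B hB hD ht hf
    obtain ⟨m, hm, M, hM, hlt, hb⟩ := exists_minmax (B := B) (by omega)
    have sub : ∀ z ∈ B, (z = m ∨ z = M) →
        (∀ x ∈ B, ∀ y ∈ B, x ≠ z → y ≠ z → x < y → s (y - x)) ∨
        (∀ x ∈ B, ∀ y ∈ B, x ≠ z → y ≠ z → x < y → ¬ s (y - x)) := by
      intro z hz hzz
      have hl := pdiff_erase_lt hm hM hlt hb hzz
      have := ih (B.erase z) (by rw [Finset.card_erase_of_mem hz]; omega) (by omega)
        (fun x hx y hy w hw => ht x (Finset.mem_of_mem_erase hx) y (Finset.mem_of_mem_erase hy)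
          w (Finset.mem_of_mem_erase hw))
        (fun x hx y hy w hw => hf x (Finset.mem_of_mem_erase hx) y (Finset.mem_of_mem_erase hy)
          w (Finset.mem_of_mem_erase hw))
      rcases this with h | h
      · left
        exact fun x hx y hy h1 h2 => h x (Finset.mem_erase.2 ⟨h1, hx⟩) y (Finset.mem_erase.2 ⟨h2, hy⟩)
      · right
        exact fun x hx y hy h1 h2 => h x (Finset.mem_erase.2 ⟨h1, hx⟩) y (Finset.mem_erase.2 ⟨h2, hy⟩)
    have hc : 1 < ((B.erase m).erase M).card := by
      rw [Finset.card_erase_of_mem (Finset.mem_erase.2 ⟨by omega, hM⟩),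
        Finset.card_erase_of_mem hm]
      omega
    obtain ⟨u, hu, v, hv, hne⟩ := Finset.one_lt_card.1 hc
    obtain ⟨u, hu, v, hv, huv⟩ : ∃ u ∈ (B.erase m).erase M, ∃ v ∈ (B.erase m).erase M, u < v := by
      rcases lt_or_gt_of_ne hne with h | h
      · exact ⟨u, hu, v, hv, h⟩
      · exact ⟨v, hv, u, hu, h⟩
    simp only [Finset.mem_erase] at hu hv
    obtain ⟨u1, u2, u3⟩ := hu
    obtain ⟨v1, v2, v3⟩ := hv
    have hmu : m < u := lt_of_le_of_ne (hb u u3).1 (Ne.symm u2)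
    have huM : u < M := lt_of_le_of_ne (hb u u3).2 u1
    rcases sub m hm (Or.inl rfl) with A | A <;> rcases sub M hM (Or.inr rfl) with C | C
    · left
      intro x hx y hy hxy
      by_cases h1 : x = m
      · by_cases h2 : y = M
        · rw [h1, h2]
          exact ht m hm u u3 M hM hmu huM (C m hm u u3 hlt.ne u1 hmu) (A u u3 M hM u2 hlt.ne' huM)
        · exact C x hx y hy (by omega) h2 hxy
      · exact A x hx y hy h1 (by have := hb x hx; omega) hxy
    · exact absurd (A u u3 v v3 u2 v2 huv) (C u u3 v v3 u1 v1 huv)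
    · exact absurd (C u u3 v v3 u1 v1 huv) (A u u3 v v3 u2 v2 huv)
    · right
      intro x hx y hy hxy
      by_cases h1 : x = m
      · by_cases h2 : y = M
        · rw [h1, h2]
          exact hf m hm u u3 M hM hmu huM (C m hm u u3 hlt.ne u1 hmu) (A u u3 M hM u2 hlt.ne' huM)
        · exact C x hx y hy (by omega) h2 hxy
      · exact A x hx y hy h1 (by have := hb x hx; omega) hxy

theorem stmt6 {n : ℕ} (hn : 5 ≤ n) (a : Fin n → ℤ)
    (hinj : Function.Injective a)
    (hcard : (diffSet a).card = n)
    -- the increasing rearrangement of `a` is not an arithmetic progression,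
    -- i.e. `a` is not a permutation of any arithmetic progression
    (hnotAP : ¬ ∃ (b d : ℤ) (σ : Equiv.Perm (Fin n)),
      ∀ i : Fin n, a i = b + ((σ i : ℕ) : ℤ) * d) :
    StrictMono a ∨ StrictAnti a := by
  have hA : ∀ i j, i < j → a j - a i ∈ diffSet a := by
    intro i j h
    exact Finset.mem_image.2 ⟨(i, j), by simpa using h, rfl⟩
  set B : Finset ℤ := Finset.univ.image a with hBdef
  have hBc : B.card = n := by rw [hBdef, Finset.card_image_of_injective _ hinj]; simp
  have hBm : ∀ i, a i ∈ B := fun i => Finset.mem_image_of_mem _ (Finset.mem_univ i)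
  have hBs : ∀ x ∈ B, ∃ i, a i = x := by
    intro x hx; simpa [hBdef] using hx
  have himg : (diffSet a).image (fun x => |x|) = pdiff B := by
    ext d
    constructor
    · intro h
      obtain ⟨x, hx, rfl⟩ := Finset.mem_image.1 h
      obtain ⟨⟨i, j⟩, hij, rfl⟩ := Finset.mem_image.1 hx
      have hij : i < j := by simpa using hij
      rcases lt_or_gt_of_ne (fun h => hij.ne (hinj h) : a i ≠ a j) with h | h
      · exact mem_pdiff.2 ⟨_, hBm i, _, hBm j, h, (abs_of_pos (sub_pos.2 h)).symm⟩
      · refine mem_pdiff.2 ⟨_, hBm j, _, hBm i, h, ?_⟩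
        show a i - a j = |a j - a i|
        rw [abs_of_neg (sub_neg.2 h)]; ring
    · intro h
      obtain ⟨x, hx, y, hy, hxy, rfl⟩ := mem_pdiff.1 h
      obtain ⟨i, rfl⟩ := hBs x hx
      obtain ⟨j, rfl⟩ := hBs y hy
      have hne : i ≠ j := by rintro rfl; omega
      rcases lt_or_gt_of_ne hne with h | h
      · exact Finset.mem_image.2 ⟨_, hA i j h, abs_of_pos (sub_pos.2 hxy)⟩
      · refine Finset.mem_image.2 ⟨_, hA j i h, ?_⟩
        show |a i - a j| = a j - a i
        rw [abs_of_neg (sub_neg.2 hxy)]; ring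
  have hle : (pdiff B).card ≤ n := by
    rw [← himg]; exact Finset.card_image_le.trans hcard.le
  have hge : n ≤ (pdiff B).card := by
    by_contra hlt
    apply hnotAP
    obtain ⟨k, rfl⟩ : ∃ k, n = k + 2 := ⟨n - 2, by omega⟩
    obtain ⟨b, d, hd, hE⟩ := ap_of_card k B hBc (by omega)
    have : ∀ i, ∃ j : Fin (k + 2), a i = b + ((j : ℕ) : ℤ) * d := by
      intro i
      have := hBm i
      rw [hE] at this
      obtain ⟨j, hj, e⟩ := Finset.mem_image.1 this
      exact ⟨⟨j, Finset.mem_range.1 hj⟩, e.symm⟩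
    choose σ hσ using this
    have hσi : Function.Injective σ := by
      intro i j h
      apply hinj
      rw [hσ i, hσ j, h]
    exact ⟨b, d, Equiv.ofBijective σ (Finite.injective_iff_bijective.1 hσi), hσ⟩
  have habs : Set.InjOn (fun x : ℤ => |x|) (diffSet a) := by
    rw [← Finset.card_image_iff, himg]; omega
  have hanti : ∀ i j, i < j → a i - a j ∉ diffSet a := by
    intro i j h hmem
    have := habs (Finset.mem_coe.2 hmem) (Finset.mem_coe.2 (hA i j h)) (abs_sub_comm _ _)
    exact h.ne (hinj (by omega))
  have hiff : ∀ i j, a j - a i ∈ diffSet a → a i ≠ a j → i < j := by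
    intro i j h hne
    by_contra hc
    rcases lt_or_eq_of_le (not_lt.1 hc) with h1 | h1
    · exact hanti j i h1 h
    · exact hne (by rw [h1])
  obtain ⟨k, hk⟩ : ∃ k, n = k + 5 := ⟨n - 5, by omega⟩
  have := allN (fun d => d ∈ diffSet a) k B (by omega) (by omega)
    (by
      intro x hx y hy z hz hxy hyz h1 h2
      obtain ⟨i, rfl⟩ := hBs x hx
      obtain ⟨j, rfl⟩ := hBs y hy
      obtain ⟨l, rfl⟩ := hBs z hz
      exact hA _ _ ((hiff i j h1 hxy.ne).trans (hiff j l h2 hyz.ne)))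
    (by
      intro x hx y hy z hz hxy hyz h1 h2 h3
      obtain ⟨i, rfl⟩ := hBs x hx
      obtain ⟨j, rfl⟩ := hBs y hy
      obtain ⟨l, rfl⟩ := hBs z hz
      have e1 : ¬ i < j := fun h => h1 (hA _ _ h)
      have e2 : ¬ j < l := fun h => h2 (hA _ _ h)
      have e3 := hiff i l h3 (by omega)
      exact absurd (lt_of_lt_of_le e3 ((not_lt.1 e2).trans (not_lt.1 e1))) (lt_irrefl _))
  rcases this with h | h
  · left
    intro i j hij
    by_contra hc
    have : a j ≠ a i := fun h => hij.ne' (hinj h)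
    exact hanti i j hij (h _ (hBm j) _ (hBm i) (by omega))
  · right
    intro i j hij
    by_contra hc
    have : a j ≠ a i := fun h => hij.ne' (hinj h)
    exact h _ (hBm i) _ (hBm j) (by omega) (hA i j hij)
end

section
/- Let n ≥ 5 and let a_1 < a_2 < ⋯ < a_n be integers whose difference set A = {a_j − a_i : 1 ≤ i < j ≤ n} has cardinality exactly n. Suppose that the first n−1 terms form an arithmetic progression, i.e. a_i = a_1 + (i−1)d for all 1 ≤ i ≤ n−1 and some integer d > 0. Then a_n = a_1 + nd. -/
theorem stmt7 {n : ℕ} (hn : 5 ≤ n) (a : Fin n → ℤ) (hmono : StrictMono a)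
    (hcard : (diffSet a).card = n) (d : ℤ) (hd : 0 < d)
    -- the first `n - 1` terms form an arithmetic progression with difference `d`
    (hAP : ∀ i : Fin n, (i : ℕ) < n - 1 → a i = a ⟨0, by omega⟩ + ((i : ℕ) : ℤ) * d) :
    a ⟨n - 1, by omega⟩ = a ⟨0, by omega⟩ + (n : ℤ) * d := by
  have hmem : ∀ z, z ∈ diffSet a ↔ ∃ i j : Fin n, i < j ∧ a j - a i = z := by
    intro z
    simp [diffSet]
  obtain ⟨x, hx⟩ : ∃ x, a ⟨n - 1, by omega⟩ = a ⟨0, by omega⟩ + x := ⟨_, (add_sub_cancel _ _).symm⟩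
  have hinj : Function.Injective (fun k : ℕ => (k : ℤ) * d) := by
    intro k l h
    have := mul_right_cancel₀ hd.ne' h
    exact_mod_cast this
  have hxgt : ((n : ℤ) - 2) * d < x := by
    have h1 : a ⟨n - 2, by omega⟩ < a ⟨n - 1, by omega⟩ :=
      hmono (by rw [Fin.mk_lt_mk]; omega)
    have h2 := hAP ⟨n - 2, by omega⟩ (by show n - 2 < n - 1; omega)
    simp only at h2
    rw [Nat.cast_sub (by omega)] at h2
    push_cast at h2
    linarith
  set S : Finset ℤ := (Finset.Icc 1 (n - 2)).image (fun k : ℕ => (k : ℤ) * d) with hS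
  have hSc : S.card = n - 2 := by
    rw [hS, Finset.card_image_of_injective _ hinj]; simp
  have hSmem : ∀ z, z ∈ S ↔ ∃ k : ℕ, (1 ≤ k ∧ k ≤ n - 2) ∧ (k : ℤ) * d = z := by
    intro z; simp [hS]
  have hSsub : ∀ z ∈ S, z ∈ diffSet a := by
    intro z hz
    obtain ⟨k, ⟨h1, h2⟩, rfl⟩ := (hSmem z).1 hz
    refine (hmem _).2 ⟨⟨0, by omega⟩, ⟨k, by omega⟩, by rw [Fin.mk_lt_mk]; omega, ?_⟩
    rw [hAP ⟨k, by omega⟩ (by show k < n - 1; omega)]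
    simp
  have hT : ∀ k : ℕ, k < n - 1 → x - k * d ∈ diffSet a := by
    intro k hk
    refine (hmem _).2 ⟨⟨k, by omega⟩, ⟨n - 1, by omega⟩, by rw [Fin.mk_lt_mk]; omega, ?_⟩
    rw [hAP ⟨k, by omega⟩ hk, hx]
    simp
  have hle : ∀ z ∈ S, z ≤ ((n : ℤ) - 2) * d := by
    intro z hz
    obtain ⟨k, ⟨h1, h2⟩, rfl⟩ := (hSmem z).1 hz
    have : (k : ℤ) ≤ (n : ℤ) - 2 := by omega
    exact mul_le_mul_of_nonneg_right this hd.le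
  have hn' : (5 : ℤ) ≤ n := by exact_mod_cast hn
  have h0 : x ∉ S := fun h => absurd (hle _ h) (by linarith)
  have h2 : x - 2 * d ∈ S := by
    by_contra h2
    have h1 : x - d ∉ S := by
      intro h1
      obtain ⟨k, ⟨hk1, hk2⟩, hk⟩ := (hSmem _).1 h1
      have : ((n : ℤ) - 3) < k := by
        by_contra hc
        push Not at hc
        nlinarith
      refine h2 ((hSmem _).2 ⟨k - 1, by omega, ?_⟩)
      rw [Nat.cast_sub hk1]; push_cast; linarith
    have hsub : insert x (insert (x - d) (insert (x - 2 * d) S)) ⊆ diffSet a := by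
      intro z hz
      simp only [Finset.mem_insert] at hz
      rcases hz with rfl | rfl | rfl | hz
      · simpa using hT 0 (by omega)
      · simpa using hT 1 (by omega)
      · simpa using hT 2 (by omega)
      · exact hSsub z hz
    have hc := Finset.card_le_card hsub
    rw [Finset.card_insert_of_notMem, Finset.card_insert_of_notMem,
      Finset.card_insert_of_notMem h2, hSc, hcard] at hc
    · omega
    · simp only [Finset.mem_insert, not_or]
      exact ⟨fun h => by linarith, h1⟩
    · simp only [Finset.mem_insert, not_or]
      exact ⟨fun h => by linarith, fun h => by linarith, h0⟩
  obtain ⟨k, ⟨hk1, hk2⟩, hk⟩ := (hSmem _).1 h2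
  have hkgt : ((n : ℤ) - 4) < k := by
    by_contra hc
    push Not at hc
    nlinarith
  have hcase : k = n - 2 ∨ k = n - 3 := by omega
  rcases hcase with rfl | rfl
  · rw [hx]
    rw [Nat.cast_sub (by omega)] at hk
    push_cast at hk
    linarith
  · exfalso
    rw [Nat.cast_sub (by omega)] at hk
    push_cast at hk
    have hall : ∀ i : Fin n, a i = a ⟨0, by omega⟩ + ((i : ℕ) : ℤ) * d := by
      intro i
      by_cases hi : (i : ℕ) < n - 1
      · exact hAP i hi
      · have : i = ⟨n - 1, by omega⟩ := by
          apply Fin.ext; show (i : ℕ) = n - 1; omega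
        rw [this, hx]
        simp only
        rw [Nat.cast_sub (by omega)]
        push_cast
        linarith
    have hsub : diffSet a ⊆ (Finset.Icc 1 (n - 1)).image (fun k : ℕ => (k : ℤ) * d) := by
      intro z hz
      obtain ⟨i, j, hij, rfl⟩ := (hmem z).1 hz
      have hij' : (i : ℕ) < j := hij
      rw [Finset.mem_image]
      refine ⟨j - i, by rw [Finset.mem_Icc]; omega, ?_⟩
      rw [hall i, hall j]
      rw [Nat.cast_sub hij'.le]
      ring
    have hc := (Finset.card_le_card hsub).trans Finset.card_image_le
    rw [hcard] at hc
    simp at hc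
    omega
end

section
/- Let a, b, d be integers with d ≥ 1 and b > a + d, and let (a_1, a_2, a_3, a_4) be a permutation of (a, a+d, b, b+d) whose difference set A = {a_j − a_i : 1 ≤ i < j ≤ 4} has cardinality exactly 4. Suppose h and λ are positive integers such that h·∏_{x ∈ A} x = 24 and λ − x ∈ A for every x ∈ A. Then d = 1, b = a + 3, the sequence is exactly (a_1, a_2, a_3, a_4) = (a, a+1, a+3, a+4), λ = 5 and h = 1. -/
def tt (d e : ℤ) (σ : Equiv.Perm (Fin 4)) : Fin 4 → ℤ := fun i => ![0, d, e, e + d] (σ i)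

def chk (d e : ℤ) : Prop := ∀ σ : Equiv.Perm (Fin 4), (diffSet (tt d e σ)).card = 4 →
  0 < ∏ x ∈ diffSet (tt d e σ), x → ∏ x ∈ diffSet (tt d e σ), x ∣ 24 →
  ∀ k ∈ Finset.range 50, (∀ x ∈ diffSet (tt d e σ), (k : ℤ) - x ∈ diffSet (tt d e σ)) →
    d = 1 ∧ e = 3 ∧ (∀ i, tt d e σ i = ![0, 1, 3, 4] i) ∧ k = 5 ∧
      ∏ x ∈ diffSet (tt d e σ), x = 24

instance (d e : ℤ) : Decidable (chk d e) := by unfold chk; infer_instance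

theorem diff_dvd (s : Fin 4 → ℤ) (h : ℤ) (hprod : h * ∏ x ∈ diffSet s, x = 24)
    (i j : Fin 4) (hij : i ≠ j) : s j - s i ∣ 24 := by
  have key : ∀ i j : Fin 4, i < j → s j - s i ∣ 24 := by
    intro i j hij
    have hm : s j - s i ∈ diffSet s := by
      unfold diffSet
      exact Finset.mem_image.2 ⟨(i, j), by simpa using hij, rfl⟩
    exact hprod ▸ Dvd.dvd.mul_left (Finset.dvd_prod_of_mem (fun x => x) hm) h
  rcases lt_or_gt_of_ne hij with h1 | h1
  · exact key i j h1
  · have := key j i h1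
    rwa [← neg_dvd, neg_sub] at this

theorem chk_all (d e : ℤ) (hd : 1 ≤ d) (he : d < e) (h1 : d ∣ 24) (h2 : e ∣ 24)
    (h3 : e - d ∣ 24) (h4 : e + d ∣ 24) : chk d e := by
  have b1 := Int.le_of_dvd (by norm_num) h4
  have fin : ∀ e ∈ Finset.range 25, ∀ d ∈ Finset.range 25, 1 ≤ (d : ℤ) → (d : ℤ) < e →
      (d : ℤ) ∣ 24 → (e : ℤ) ∣ 24 → (e : ℤ) - d ∣ 24 → (e : ℤ) + d ∣ 24 → chk d e := by
    decide +kernel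
  lift d to ℕ using by omega
  lift e to ℕ using by omega
  exact fin e (by simp; omega) d (by simp; omega) hd he h1 h2 h3 h4

theorem stmt13 (a b d : ℤ) (hd : 1 ≤ d) (hb : a + d < b) (s : Fin 4 → ℤ)
    -- `s` is a permutation of `(a, a+d, b, b+d)`
    (hperm : ∃ σ : Equiv.Perm (Fin 4), ∀ i, s i = ![a, a + d, b, b + d] (σ i))
    (hcard : (diffSet s).card = 4)
    (h lam : ℤ) (hh : 1 ≤ h) (hlam : 1 ≤ lam)
    (hprod : h * ∏ x ∈ diffSet s, x = 24)
    (hserre : ∀ x ∈ diffSet s, lam - x ∈ diffSet s) :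
    d = 1 ∧ b = a + 3 ∧ s = ![a, a + 1, a + 3, a + 4] ∧ lam = 5 ∧ h = 1 := by
  obtain ⟨σ, hσ⟩ := hperm
  have hst : ∀ i, s i = a + tt d (b - a) σ i := by
    intro i
    rw [hσ, tt]
    generalize σ i = k
    fin_cases k <;> simp <;> ring
  have hD : diffSet s = diffSet (tt d (b - a) σ) := by
    unfold diffSet
    congr 1
    funext p
    rw [hst, hst]; ring
  have dv : ∀ k l : Fin 4, k ≠ l →
      ![a, a + d, b, b + d] l - ![a, a + d, b, b + d] k ∣ 24 := by
    intro k l hkl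
    have := diff_dvd s h hprod (σ.symm k) (σ.symm l) (by simpa using hkl)
    simpa [hσ] using this
  have d1 : d ∣ 24 := by simpa using dv 0 1 (by decide)
  have d2 : b - a ∣ 24 := by simpa using dv 0 2 (by decide)
  have d3 : b - a - d ∣ 24 := by
    have := dv 1 2 (by decide)
    simp at this
    rwa [show b - a - d = b - (a + d) by ring]
  have d4 : b - a + d ∣ 24 := by
    have := dv 0 3 (by decide)
    simp at this
    rwa [show b - a + d = b + d - a by ring]
  have hc := chk_all d (b - a) hd (by omega) d1 d2 d3 d4
  have hP : 0 < ∏ x ∈ diffSet s, x := by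
    by_contra hn
    nlinarith
  have hm : s 1 - s 0 ∈ diffSet s := by
    unfold diffSet
    exact Finset.mem_image.2 ⟨(0, 1), by simp, rfl⟩
  have le24 : ∀ x ∈ diffSet s, x ≤ 24 := by
    intro x hx
    exact Int.le_of_dvd (by norm_num)
      (hprod ▸ Dvd.dvd.mul_left (Finset.dvd_prod_of_mem (fun x => x) hx) h)
  have l1 := le24 _ hm
  have l2 := le24 _ (hserre _ hm)
  lift lam to ℕ using by omega
  have hdv : ∏ x ∈ diffSet s, x ∣ 24 := ⟨h, by rw [← hprod]; ring⟩
  rw [hD] at hcard hprod hserre hP hdv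
  obtain ⟨r1, r2, r3, r4, r5⟩ := hc σ hcard hP hdv lam (by simp; omega) hserre
  refine ⟨r1, by omega, ?_, by omega, by rw [r5] at hprod; omega⟩
  funext i
  rw [hst, r3]
  fin_cases i <;> simp
end
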